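/- For every real ε > 0 there exists an integer N = N(ε) such that for all n ≥ N, every regular simple graph of order 2n with degree at least (1+ε)·n is 1-factorizable. -/

import Mathlib

/-- A simple graph is 1-factorizable if its edge set can be partitioned into
1-factors (perfect matchings): there is a family of perfect matchings such that
every edge of the graph lies in exactly one of them. -/
def SimpleGraph.OneFactorizable {V : Type*} (G : SimpleGraph V) : Prop :=
  ∃ (k : ℕ) (F : Fin k → G.Subgraph),
    (∀ i, (F i).IsPerfectMatching) ∧
    ∀ e ∈ G.edgeSet, ∃! i, e ∈ (F i).edgeSet

section
open Finset

/-- `G` with the edges of the matching `P` removed. -/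
def SimpleGraph.removeMatching {V : Type*} (G : SimpleGraph V) (P : V → V) : SimpleGraph V where
  Adj v w := G.Adj v w ∧ P v ≠ w ∧ P w ≠ v
  symm := ⟨fun _ _ h => ⟨h.1.symm, h.2.2, h.2.1⟩⟩
  loopless := ⟨fun _ h => h.1.ne rfl⟩

section
variable {V : Type*} {G : SimpleGraph V} {P : V → V}

lemma SimpleGraph.removeMatching_adj (hP : Function.Involutive P) {v w : V} :
    (G.removeMatching P).Adj v w ↔ G.Adj v w ∧ P v ≠ w := by
  refine ⟨fun h => ⟨h.1, h.2.1⟩, fun h => ⟨h.1, h.2, fun h' => h.2 ?_⟩⟩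
  rw [← h', hP]

lemma SimpleGraph.oneFactorizable_of_forall_not_adj (h : ∀ v w, ¬ G.Adj v w) :
    G.OneFactorizable := by
  refine ⟨0, Fin.elim0, fun i => i.elim0, fun e => ?_⟩
  induction e with
  | _ v w => exact fun he => absurd he (h v w)

lemma SimpleGraph.OneFactorizable.of_removeMatching (hP : Function.Involutive P)
    (hPG : ∀ v, G.Adj v (P v)) (h : (G.removeMatching P).OneFactorizable) :
    G.OneFactorizable := by
  obtain ⟨k, F, hF, hFe⟩ := h
  let F₀ : G.Subgraph :=
    { verts := Set.univ
      Adj := fun v w => P v = w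
      adj_sub := fun h => h ▸ hPG _
      edge_vert := fun _ => trivial
      symm := ⟨fun v w h => by rw [← h, hP]⟩ }
  let F' : Fin k → G.Subgraph := fun i =>
    { verts := (F i).verts
      Adj := (F i).Adj
      adj_sub := fun h => ((F i).adj_sub h).1
      edge_vert := (F i).edge_vert
      symm := (F i).symm }
  refine ⟨k + 1, Fin.cons F₀ F', ?_, ?_⟩
  · refine Fin.cases ?_ fun i => ?_
    · exact ⟨fun v _ => ⟨P v, rfl, fun w hw => Eq.symm hw⟩, fun v => trivial⟩
    · exact ⟨(hF i).1, (hF i).2⟩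
  · intro e
    induction e with
    | _ v w =>
    intro he
    have hadj : G.Adj v w := he
    by_cases hvw : P v = w
    · refine ⟨0, hvw, Fin.cases (fun _ => rfl) fun i hi => ?_⟩
      have : (F i).Adj v w := hi
      exact absurd hvw ((F i).adj_sub this).2.1
    · obtain ⟨i, hi, hiu⟩ := hFe s(v, w) ((removeMatching_adj hP).2 ⟨hadj, hvw⟩)
      refine ⟨i.succ, hi, Fin.cases (fun h => absurd h hvw) fun j hj => ?_⟩
      rw [hiu j hj]

end

section
open scoped Classical
variable {V : Type*} [Fintype V] {G : SimpleGraph V} {P : V → V}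

lemma SimpleGraph.card_removeMatching (hP : Function.Involutive P) (hPG : ∀ v, G.Adj v (P v))
    (v : V) : #{w | (G.removeMatching P).Adj v w} + 1 = #{w | G.Adj v w} := by
  have : ({w | (G.removeMatching P).Adj v w} : Finset V) =
      ({w | G.Adj v w} : Finset V).erase (P v) := by
    ext w
    simp only [mem_filter, mem_univ, true_and, mem_erase, removeMatching_adj hP]
    tauto
  rw [this, card_erase_add_one (by simpa using hPG v)]

/-- In a square matrix of naturals with constant positive row and column sums there is a positive
transversal. -/
lemma exists_perm_pos_of_sums {r : V → V → ℕ} {k : ℕ} (hk : 0 < k) (hrow : ∀ a, ∑ b, r a b = k)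
    (hcol : ∀ b, ∑ a, r a b = k) : ∃ σ : Equiv.Perm V, ∀ a, 0 < r a (σ a) := by
  obtain ⟨f, hf, hfr⟩ := (Finset.all_card_le_biUnion_card_iff_exists_injective
    (fun a : V => ({b | 0 < r a b} : Finset V))).1 fun X => by
    set N := X.biUnion fun a : V => ({b | 0 < r a b} : Finset V) with hN
    refine Nat.le_of_mul_le_mul_left ?_ hk
    calc k * #X = ∑ a ∈ X, ∑ b, r a b := by simp [hrow, mul_comm]
      _ = ∑ a ∈ X, ∑ b ∈ N, r a b := by
        refine sum_congr rfl fun a ha => (sum_subset (subset_univ _) fun b _ hb => ?_).symm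
        by_contra hpos
        exact hb (mem_biUnion.2 ⟨a, ha, by simpa [Nat.pos_iff_ne_zero] using hpos⟩)
      _ = ∑ b ∈ N, ∑ a ∈ X, r a b := sum_comm
      _ ≤ ∑ b ∈ N, ∑ a, r a b := sum_le_sum fun b _ => sum_le_sum_of_subset (subset_univ _)
      _ = k * #N := by simp [hcol, mul_comm]
  refine ⟨Equiv.ofBijective f (Finite.injective_iff_bijective.1 hf), fun a => ?_⟩
  simpa using hfr a

/-- The positive entries of a square matrix of naturals with all row and column sums `k` are covered
by `k` permutations. -/
lemma exists_perms_cover_of_sums (k : ℕ) : ∀ r : V → V → ℕ, (∀ a, ∑ b, r a b = k) →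
    (∀ b, ∑ a, r a b = k) →
    ∃ σ : ℕ → Equiv.Perm V, ∀ a b, 0 < r a b → ∃ i < k, σ i a = b := by
  induction k with
  | zero =>
    intro r hrow _
    refine ⟨fun _ => 1, fun a b hab => ?_⟩
    have := Finset.sum_eq_zero_iff.1 (hrow a) b (mem_univ _)
    omega
  | succ k ih =>
    intro r hrow hcol
    obtain ⟨τ, hτ⟩ := exists_perm_pos_of_sums (Nat.succ_pos k) hrow hcol
    have hle : ∀ a b, (if τ a = b then 1 else 0) ≤ r a b := fun a b => by
      split_ifs with h
      · exact h ▸ hτ a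
      · exact Nat.zero_le _
    obtain ⟨σ, hσ⟩ := ih (fun a b => r a b - if τ a = b then 1 else 0)
      (fun a => by
        rw [Finset.sum_tsub_distrib _ fun b _ => hle a b, hrow]
        simp)
      (fun b => by
        rw [Finset.sum_tsub_distrib _ fun a _ => hle a b, hcol]
        simp [← Equiv.eq_symm_apply])
    refine ⟨fun i => if i = k then τ else σ i, fun a b hab => ?_⟩
    by_cases h : τ a = b
    · exact ⟨k, by omega, by simpa using h⟩
    · obtain ⟨i, hi, hib⟩ := hσ a b (by simpa [h] using hab)
      exact ⟨i, by omega, by simpa [hi.ne] using hib⟩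

/-- **König's theorem**: a bipartite graph of maximum degree at most `k` has a proper edge colouring
with `k` colours. -/
lemma SimpleGraph.exists_edgeColoring_of_bipartite {s : V → Bool} {k : ℕ}
    (hs : ∀ v w, G.Adj v w → s v ≠ s w) (hk : ∀ v, #{w | G.Adj v w} ≤ k) :
    ∃ c : V → V → ℕ, (∀ v w, c v w = c w v) ∧ (∀ v w, G.Adj v w → c v w < k) ∧
      ∀ v w w', G.Adj v w → G.Adj v w' → c v w = c v w' → w = w' := by
  let r : V ⊕ V → V ⊕ V → ℕ
    | .inl a, .inl b => if G.Adj a b then 1 else 0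
    | .inr a, .inr b => if G.Adj a b then 1 else 0
    | .inl a, .inr b => if a = b then k - #{w | G.Adj a w} else 0
    | .inr a, .inl b => if a = b then k - #{w | G.Adj a w} else 0
  have hsymm : ∀ x y, r x y = r y x := by
    rintro (a | a) (b | b) <;> simp only [r, G.adj_comm a b, eq_comm (a := a)] <;>
      split_ifs with h <;> simp [h]
  have hrow : ∀ x, ∑ y, r x y = k := by
    rintro (a | a)
    · have := hk a
      simp only [Fintype.sum_sum_type, r, sum_boole, sum_ite_eq, mem_univ, if_true, Nat.cast_id]
      omega
    · have := hk a
      simp only [Fintype.sum_sum_type, r, sum_boole, sum_ite_eq, mem_univ, if_true, Nat.cast_id]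
      omega
  obtain ⟨σ, hσ⟩ := exists_perms_cover_of_sums k r hrow
    (fun y => by rw [← hrow y]; exact sum_congr rfl fun x _ => hsymm x y)
  have hex : ∀ a b, ∃ i, G.Adj a b → i < k ∧ σ i (.inl a) = .inl b := fun a b => by
    by_cases hab : G.Adj a b
    · obtain ⟨i, hi, hib⟩ := hσ (.inl a) (.inl b) (by simp [r, hab])
      exact ⟨i, fun _ => ⟨hi, hib⟩⟩
    · exact ⟨0, fun h => absurd h hab⟩
  choose i hi using hex
  refine ⟨fun v w => if s v = s w then 0 else if s v then i v w else i w v, ?_, ?_, ?_⟩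
  · intro v w
    cases hv : s v <;> cases hw : s w <;> simp [hv, hw]
  · intro v w hvw
    have h1 := hs v w hvw
    have h2 := (hi v w hvw).1
    have h3 := (hi w v hvw.symm).1
    simp only [h1, if_false]
    split_ifs <;> assumption
  · intro v w w' hw hw' hc
    have h1 := hs v w hw
    have h2 := hs v w' hw'
    simp only [h1, h2, if_false] at hc
    split_ifs at hc
    · have h3 := (hi v w hw).2
      have h4 := (hi v w' hw').2
      rw [hc, h4] at h3
      exact (Sum.inl_injective h3).symm
    · have h3 := (hi w v hw.symm).2
      have h4 := (hi w' v hw'.symm).2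
      rw [← hc, ← h3] at h4
      exact (Sum.inl_injective ((σ _).injective h4)).symm

/-- A regular bipartite graph is 1-factorizable. -/
lemma SimpleGraph.oneFactorizable_of_bipartite {s : V → Bool} (k : ℕ) : ∀ G : SimpleGraph V,
    (∀ v w, G.Adj v w → s v ≠ s w) → (∀ v, #{w | G.Adj v w} = k) → G.OneFactorizable := by
  induction k with
  | zero =>
    intro G _ hk
    refine oneFactorizable_of_forall_not_adj fun v w hvw => ?_
    have : w ∈ ({w | G.Adj v w} : Finset V) := by simpa using hvw
    rw [card_eq_zero.1 (hk v)] at this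
    simp at this
  | succ k ih =>
    intro G hs hk
    obtain ⟨σ, hσ⟩ := exists_perm_pos_of_sums (r := fun a b => if G.Adj a b then 1 else 0)
      (Nat.succ_pos k) (fun a => by simpa using hk a)
      (fun b => by simpa [G.adj_comm] using hk b)
    have hσ' : ∀ a, G.Adj a (σ a) := fun a => by
      by_contra h
      simpa [h] using hσ a
    have hσs : ∀ a, s (σ a) = !(s a) := fun a => Bool.eq_not.2 (hs _ _ (hσ' a)).symm
    have hσs' : ∀ a, s (σ.symm a) = !(s a) := fun a => by
      have := hσs (σ.symm a)
      rw [Equiv.apply_symm_apply] at this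
      rw [this, Bool.not_not]
    set P : V → V := fun v => if s v then σ v else σ.symm v with hPdef
    have hP : Function.Involutive P := fun v => by
      cases h : s v <;> simp [hPdef, h, hσs, hσs']
    have hPG : ∀ v, G.Adj v (P v) := fun v => by
      cases h : s v
      · have := hσ' (σ.symm v)
        rw [Equiv.apply_symm_apply] at this
        simpa [hPdef, h] using this.symm
      · simpa [hPdef, h] using hσ' v
    refine .of_removeMatching hP hPG (ih _ (fun v w h => hs v w h.1) fun v => ?_)
    have := card_removeMatching hP hPG v
    have := hk v
    omega
end

open scoped Classical in
/-- `P` arises from `M` by deleting some edges avoiding `S` and adding edges of `G` across `s`;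
at most `t` vertices are affected. -/
structure IsRewiring {V : Type*} [Fintype V] (G : SimpleGraph V) (s : V → Bool) (M : V → V)
    (S : Finset V) (P : V → V) (t : ℕ) : Prop where
  invol : Function.Involutive P
  cases : ∀ v, P v = v ∨ P v = M v ∨ (G.Adj v (P v) ∧ s (P v) ≠ s v)
  avoid : ∀ v ∈ S, M v ≠ v → P v = M v
  card_le : #{v | P v ≠ M v} ≤ t

section
open scoped Classical
variable {V : Type*} [Fintype V] {G : SimpleGraph V} {s : V → Bool} {M P : V → V} {S : Finset V}
  {n h m σ t : ℕ}

lemma exists_rewirable_edge (hs : ∀ b, #{v | s v = b} = n) (hM : Function.Involutive M)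
    (hMs : ∀ v, s (M v) = s v) (hm : #{v | M v = v} ≤ m) (hS : #S ≤ σ)
    (hc : ∀ v, h ≤ #{w | G.Adj v w ∧ s w ≠ s v}) (ht : #{v | P v ≠ M v} ≤ t)
    (hn : n + t + m + 2 * σ < 2 * h) {a a' : V} (ha : s a = s a') :
    ∃ b, G.Adj a b ∧ s b ≠ s a ∧ P b = M b ∧ M b ≠ b ∧ b ∉ S ∧ M b ∉ S ∧ G.Adj a' (M b) := by
  by_contra! hcon
  set bad : Finset V := (({v | P v ≠ M v} : Finset V) ∪ ({v | M v = v} : Finset V)) ∪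
    (S ∪ S.image M) with hbad
  have hbadc : #bad ≤ t + m + 2 * σ := by
    have h1 := card_union_le (({v | P v ≠ M v} : Finset V) ∪ ({v | M v = v} : Finset V))
      (S ∪ S.image M)
    have h2 := card_union_le ({v | P v ≠ M v} : Finset V) ({v | M v = v} : Finset V)
    have h3 := card_union_le S (S.image M)
    have h4 := card_image_le (s := S) (f := M)
    rw [hbad]
    omega
  set X : Finset V := ({w | G.Adj a w ∧ s w ≠ s a} : Finset V) \ bad with hX
  have hXc : h ≤ #X + #bad := by
    have := card_le_card_sdiff_add_card (s := ({w | G.Adj a w ∧ s w ≠ s a} : Finset V)) (t := bad)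
    have := hc a
    rw [hX]
    omega
  set Y : Finset V := {w | G.Adj a' w ∧ s w ≠ s a'} with hY
  have hdisj : Disjoint (X.image M) Y := by
    rw [Finset.disjoint_left]
    intro w hw hwY
    obtain ⟨b, hb, rfl⟩ := mem_image.1 hw
    simp only [hX, hbad, mem_sdiff, mem_filter, mem_univ, true_and, mem_union, not_or,
      ne_eq, not_not, mem_image, not_exists, not_and] at hb
    obtain ⟨⟨hb1, hb2⟩, ⟨hb3, hb4⟩, hb5, hb6⟩ := hb
    refine hcon b hb1 hb2 hb3 hb4 hb5 (fun hc => hb6 _ hc (hM b)) ?_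
    simpa [hY] using (mem_filter.1 hwY).2.1
  have hsub : X.image M ∪ Y ⊆ ({v | s v = !(s a)} : Finset V) := by
    intro w hw
    rw [mem_filter]
    refine ⟨mem_univ _, ?_⟩
    rcases mem_union.1 hw with hw | hw
    · obtain ⟨b, hb, rfl⟩ := mem_image.1 hw
      have : s b ≠ s a := (mem_filter.1 (mem_sdiff.1 hb).1).2.2
      rw [hMs]
      exact Bool.eq_not.2 this
    · have := (mem_filter.1 hw).2.2
      rw [ha]
      exact Bool.eq_not.2 this
  have h1 := card_le_card hsub
  rw [hs, card_union_of_disjoint hdisj, card_image_of_injective _ hM.injective] at h1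
  have h2 : h ≤ #Y := hc a'
  omega

/-- Move the uncovered vertex `a` to the other side. -/
lemma IsRewiring.move (hs : ∀ b, #{v | s v = b} = n) (hM : Function.Involutive M)
    (hMs : ∀ v, s (M v) = s v) (hm : #{v | M v = v} ≤ m) (hS : #S ≤ σ)
    (hc : ∀ v, h ≤ #{w | G.Adj v w ∧ s w ≠ s v}) (hP : IsRewiring G s M S P t)
    (hn : n + t + m + 2 * σ < 2 * h) {a : V} (ha : P a = a) :
    ∃ P' c, IsRewiring G s M S P' (t + 3) ∧ s c ≠ s a ∧ P c ≠ c ∧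
      ∀ v, P' v = v ↔ (P v = v ∧ v ≠ a) ∨ v = c := by
  obtain ⟨b, hb1, hb2, hb3, hb4, hb5, hb6, -⟩ :=
    exists_rewirable_edge hs hM hMs hm hS hc hP.card_le hn (rfl : s a = s a)
  have hPb : P (M b) = b := by rw [← hb3, hP.invol]
  have hPi := hP.invol
  have hMb := hM b
  have hab : a ≠ b := hb1.ne
  have hMba : M b ≠ a := by grind
  refine ⟨fun v => if v = a then b else if v = b then a else if v = M b then M b else P v,
    M b, ⟨?_, ?_, ?_, ?_⟩, by rwa [hMs], by grind, ?_⟩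
  · intro v
    have := hPi v
    grind
  · intro v
    have := hP.cases v
    have := hb1.symm
    grind
  · intro v hv hMv
    have := hP.avoid v hv hMv
    grind
  · have : ({v | (if v = a then b else if v = b then a else if v = M b then M b else P v) ≠ M v} :
        Finset V) ⊆ ({v | P v ≠ M v} : Finset V) ∪ {a, b, M b} := by
      intro v
      simp only [mem_filter, mem_univ, true_and, mem_union, mem_insert, mem_singleton]
      grind
    have h1 := card_le_card this
    have h2 := card_union_le ({v | P v ≠ M v} : Finset V) {a, b, M b}
    have h3 := card_le_three (a := a) (b := b) (c := M b)
    have h4 := hP.card_le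
    omega
  · intro v
    have := hPi v
    grind

/-- Cover two uncovered vertices on the same side. -/
lemma IsRewiring.join (hs : ∀ b, #{v | s v = b} = n) (hM : Function.Involutive M)
    (hMs : ∀ v, s (M v) = s v) (hm : #{v | M v = v} ≤ m) (hS : #S ≤ σ)
    (hc : ∀ v, h ≤ #{w | G.Adj v w ∧ s w ≠ s v}) (hP : IsRewiring G s M S P t)
    (hn : n + t + m + 2 * σ < 2 * h) {a a' : V} (ha : P a = a) (ha' : P a' = a') (haa : a ≠ a')
    (hsa : s a = s a') :
    ∃ P', IsRewiring G s M S P' (t + 4) ∧ ∀ v, P' v = v ↔ P v = v ∧ v ≠ a ∧ v ≠ a' := by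
  obtain ⟨b, hb1, hb2, hb3, hb4, hb5, hb6, hb7⟩ :=
    exists_rewirable_edge hs hM hMs hm hS hc hP.card_le hn hsa
  have hPb : P (M b) = b := by rw [← hb3, hP.invol]
  have hPi := hP.invol
  have hMb := hM b
  have hab : a ≠ b := hb1.ne
  have hMba : M b ≠ a := by grind
  have hab' : a' ≠ b := by grind
  have hMba' : M b ≠ a' := by grind
  have hsb := hMs b
  refine ⟨fun v => if v = a then b else if v = b then a else if v = a' then M b else
    if v = M b then a' else P v, ⟨?_, ?_, ?_, ?_⟩, ?_⟩
  · intro v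
    have := hPi v
    grind
  · intro v
    have := hP.cases v
    have := hb1.symm
    have := hb7.symm
    grind
  · intro v hv hMv
    have := hP.avoid v hv hMv
    grind
  · have : ({v | (if v = a then b else if v = b then a else if v = a' then M b else
        if v = M b then a' else P v) ≠ M v} :
        Finset V) ⊆ ({v | P v ≠ M v} : Finset V) ∪ {a, b, a', M b} := by
      intro v
      simp only [mem_filter, mem_univ, true_and, mem_union, mem_insert, mem_singleton]
      grind
    have h1 := card_le_card this
    have h2 := card_union_le ({v | P v ≠ M v} : Finset V) {a, b, a', M b}
    have h3 := card_le_four (a := a) (b := b) (c := a') (d := M b)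
    have h4 := hP.card_le
    omega
  · intro v
    have := hPi v
    grind

lemma even_card_fixed_of_involutive (hP : Function.Involutive P) (hV : Even (Fintype.card V)) :
    Even #{v | P v = v} := by
  have h := Equiv.Perm.card_fixedPoints_modEq (p := 2) (n := 1) (f := P)
    (by funext v; exact hP v)
  have h2 : Fintype.card (Function.fixedPoints P) = #{v | P v = v} := by
    rw [Fintype.card_subtype]
    congr 1
  rw [Nat.even_iff] at hV ⊢
  rw [← h2]
  unfold Nat.ModEq at h
  omega

lemma card_eq_two_mul_of_sides (hs : ∀ b, #{v | s v = b} = n) : Fintype.card V = 2 * n := by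
  have := card_filter_add_card_filter_not (s := (univ : Finset V)) (fun v => s v = true)
  have h1 := hs true
  have h2 := hs false
  simp only [Bool.not_eq_true] at this
  rw [h1, h2, card_univ] at this
  omega

lemma IsRewiring.exists_perfect (hs : ∀ b, #{v | s v = b} = n) (hM : Function.Involutive M)
    (hMs : ∀ v, s (M v) = s v) (hm : #{v | M v = v} ≤ m) (hS : #S ≤ σ)
    (hc : ∀ v, h ≤ #{w | G.Adj v w ∧ s w ≠ s v})
    (hn : n + 5 * m + 2 * σ < 2 * h) (f : ℕ) : ∀ (P : V → V) (t : ℕ), IsRewiring G s M S P t →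
    #{v | P v = v} = f → t + 4 * f ≤ 4 * m →
    ∃ P', IsRewiring G s M S P' (4 * m) ∧ ∀ v, P' v ≠ v := by
  induction f using Nat.strong_induction_on with
  | _ f ih =>
  intro P t hP hf ht
  have hev := even_card_fixed_of_involutive hP.invol ⟨n, by
    rw [card_eq_two_mul_of_sides hs]; ring⟩
  rcases Nat.eq_zero_or_pos f with rfl | hfpos
  · refine ⟨P, ⟨hP.invol, hP.cases, hP.avoid, hP.card_le.trans (by omega)⟩, fun v hv => ?_⟩
    rw [card_eq_zero] at hf
    have : v ∈ ({v | P v = v} : Finset V) := by simpa using hv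
    simp [hf] at this
  have hone : 1 < #{v | P v = v} := by
    rw [hf] at hev ⊢
    obtain ⟨r, hr⟩ := hev
    omega
  have key : ∀ a a' P' t', P a = a → P a' = a' → a ≠ a' → IsRewiring G s M S P' t' → t' ≤ t + 8 →
      (∀ v, P' v = v ↔ P v = v ∧ v ≠ a ∧ v ≠ a') →
      ∃ P', IsRewiring G s M S P' (4 * m) ∧ ∀ v, P' v ≠ v := by
    intro a a' P' t' ha ha' haa hP' ht' hfix
    have hcard : #{v | P' v = v} + 2 = f := by
      rw [← hf, ← card_pair haa, ← card_union_of_disjoint]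
      · congr 1
        ext v
        simp only [mem_union, mem_filter, mem_univ, true_and, mem_insert, mem_singleton, hfix]
        grind
      · rw [Finset.disjoint_left]
        intro v hv
        simp only [mem_filter, mem_univ, true_and, hfix] at hv
        simp [hv.2.1, hv.2.2]
    exact ih _ (by omega) P' t' hP' rfl (by omega)
  by_cases hex : ∃ a a', P a = a ∧ P a' = a' ∧ a ≠ a' ∧ s a = s a'
  · obtain ⟨a, a', ha, ha', haa, hsa⟩ := hex
    obtain ⟨P', hP', hfix⟩ := hP.join hs hM hMs hm hS hc (by omega) ha ha' haa hsa
    exact key a a' P' _ ha ha' haa hP' (by omega) hfix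
  · obtain ⟨a, ha, a', ha', haa⟩ := one_lt_card.1 hone
    simp only [mem_filter, mem_univ, true_and] at ha ha'
    have hsa : s a ≠ s a' := fun h => hex ⟨a, a', ha, ha', haa, h⟩
    obtain ⟨P₁, c, hP₁, hsc, hcc, hfix₁⟩ := hP.move hs hM hMs hm hS hc (by omega) ha
    have hca : c ≠ a' := fun h => hcc (h ▸ ha')
    obtain ⟨P', hP', hfix⟩ := hP₁.join hs hM hMs hm hS hc (by omega)
      ((hfix₁ c).2 (Or.inr rfl)) ((hfix₁ a').2 (Or.inl ⟨ha', haa.symm⟩)) hca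
      (by revert hsc hsa; cases s a <;> cases s a' <;> cases s c <;> simp)
    refine key a a' P' _ ha ha' haa hP' (by omega) fun v => ?_
    rw [hfix, hfix₁]
    grind

/-- A matching inside the sides of a dense balanced bipartition which misses few vertices can be
turned into a perfect matching by removing few edges and adding edges across. -/
lemma exists_factor_of_matching (hs : ∀ b, #{v | s v = b} = n) (hM : Function.Involutive M)
    (hMs : ∀ v, s (M v) = s v) (hMG : ∀ v, M v ≠ v → G.Adj v (M v))
    (hm : #{v | M v = v} ≤ m) (hS : #S ≤ σ)
    (hc : ∀ v, h ≤ #{w | G.Adj v w ∧ s w ≠ s v})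
    (hn : n + 5 * m + 2 * σ < 2 * h) :
    ∃ P : V → V, Function.Involutive P ∧ (∀ v, G.Adj v (P v)) ∧ (∀ v, s (P v) = s v → P v = M v) ∧
      (∀ v ∈ S, M v ≠ v → P v = M v) ∧ #{v | P v ≠ M v} ≤ 4 * m := by
  obtain ⟨P, hP, hfix⟩ := IsRewiring.exists_perfect (G := G) hs hM hMs hm hS hc hn _ M 0
    ⟨hM, by simp, by simp, by simp⟩ rfl (by omega)
  refine ⟨P, hP.invol, fun v => ?_, fun v hv => ?_, hP.avoid, hP.card_le⟩
  · rcases hP.cases v with h | h | h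
    · exact absurd h (hfix v)
    · rw [h]
      exact hMG v (h ▸ hfix v)
    · exact h.1
  · rcases hP.cases v with h | h | h
    · exact absurd h (hfix v)
    · exact h
    · exact absurd hv h.2

end

section
open scoped Classical
variable {V : Type*} [Fintype V] {G : SimpleGraph V} {s : V → Bool} {M P : V → V} {S : Finset V}
  {n h m σ t w : ℕ}

lemma card_across_sdiff_moved (hw : ∀ b, #{v | M v ≠ v ∧ s v = b} ≤ w)
    (hc : ∀ v, h ≤ #{w | G.Adj v w ∧ s w ≠ s v}) (a : V) :
    h ≤ #{x | (G.Adj a x ∧ s x ≠ s a) ∧ M x = x} + w := by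
  have h1 := hc a
  have h2 := hw (!(s a))
  rw [← card_filter_add_card_filter_not (fun x => M x = x), filter_filter, filter_filter] at h1
  have h3 : #{x | (G.Adj a x ∧ s x ≠ s a) ∧ ¬ M x = x} ≤ #{v | M v ≠ v ∧ s v = !(s a)} := by
    apply card_le_card
    intro x
    simp only [mem_filter, mem_univ, true_and]
    rintro ⟨⟨-, hx⟩, hMx⟩
    exact ⟨hMx, Bool.eq_not.2 hx⟩
  omega

lemma exists_swap_extension (hs : ∀ b, #{v | s v = b} = n)
    (hw : ∀ b, #{v | M v ≠ v ∧ s v = b} ≤ w)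
    (hc : ∀ v, h ≤ #{w | G.Adj v w ∧ s w ≠ s v}) (hn : n + 2 * w < 2 * h)
    (hPi : Function.Involutive P) (hPM : ∀ v, M v ≠ v → P v = M v)
    (hP : ∀ v, P v = v ∨ P v = M v ∨ (G.Adj v (P v) ∧ s (P v) ≠ s v))
    {a b : V} (ha : P a = a) (hb : P b = b) (hsab : s a ≠ s b) :
    ∃ P' : V → V, Function.Involutive P' ∧ (∀ v, M v ≠ v → P' v = M v) ∧
      (∀ v, P' v = v ∨ P' v = M v ∨ (G.Adj v (P' v) ∧ s (P' v) ≠ s v)) ∧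
      ∃ c, s c = s b ∧ P c = c ∧ ∀ v, P' v = v ↔ P v = v ∧ v ≠ a ∧ v ≠ c := by
  by_cases hX : ∃ x, (G.Adj a x ∧ s x ≠ s a) ∧ M x = x ∧ P x = x
  · obtain ⟨x, ⟨hax, hsx⟩, hMx, hPx⟩ := hX
    have := hax.ne
    refine ⟨fun v => if v = a then x else if v = x then a else P v, ?_, ?_, ?_, x, ?_, hPx, ?_⟩
    · intro v
      have := hPi v
      grind
    · intro v hv
      have := hPM v hv
      grind
    · intro v
      have := hP v
      have := hax.symm
      grind
    · rw [Bool.eq_not.2 hsx, Bool.eq_not.2 hsab, Bool.not_not]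
    · intro v
      grind
  push Not at hX
  set X : Finset V := {x | (G.Adj a x ∧ s x ≠ s a) ∧ M x = x} with hXdef
  set Y : Finset V := {x | (G.Adj b x ∧ s x ≠ s b) ∧ M x = x} with hYdef
  have hXc : h ≤ #X + w := card_across_sdiff_moved hw hc a
  have hYc : h ≤ #Y + w := card_across_sdiff_moved hw hc b
  have hnd : ¬ Disjoint (X.image P) Y := by
    intro hd
    have hsub : X.image P ∪ Y ⊆ ({v | s v = s a} : Finset V) := by
      intro v hv
      rw [mem_filter]
      refine ⟨mem_univ _, ?_⟩
      rcases mem_union.1 hv with hv | hv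
      · obtain ⟨x, hx, rfl⟩ := mem_image.1 hv
        simp only [hXdef, mem_filter, mem_univ, true_and] at hx
        have h1 := hX x hx.1 hx.2
        have h2 : s (P x) ≠ s x := by
          have := hP x
          grind
        rw [Bool.eq_not.2 h2, Bool.eq_not.2 hx.1.2, Bool.not_not]
      · have := (mem_filter.1 hv).2.1.2
        rw [Bool.eq_not.2 this, Bool.eq_not.2 hsab]
    have h1 := card_le_card hsub
    rw [hs, card_union_of_disjoint hd, card_image_of_injective _ hPi.injective] at h1
    omega
  obtain ⟨y, hy1, hy2⟩ := Finset.not_disjoint_iff.1 hnd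
  obtain ⟨x, hx, rfl⟩ := mem_image.1 hy1
  simp only [hXdef, hYdef, mem_filter, mem_univ, true_and] at hx hy2
  obtain ⟨⟨hax, hsx⟩, hMx⟩ := hx
  obtain ⟨⟨hbx, hsbx⟩, hMPx⟩ := hy2
  have hPx := hX x ⟨hax, hsx⟩ hMx
  have hPPx := hPi x
  have h1 := hax.ne
  have h2 := hbx.ne
  have h3 : a ≠ P x := by grind
  have h4 : b ≠ x := by grind
  refine ⟨fun v => if v = a then x else if v = x then a else if v = b then P x else
    if v = P x then b else P v, ?_, ?_, ?_, b, rfl, hb, ?_⟩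
  · intro v
    have := hPi v
    grind
  · intro v hv
    have := hPM v hv
    grind
  · intro v
    have := hP v
    have := hax.symm
    have := hbx.symm
    grind
  · intro v
    have := hPi v
    grind

lemma exists_perfect_extension (hs : ∀ b, #{v | s v = b} = n)
    (hw : ∀ b, #{v | M v ≠ v ∧ s v = b} ≤ w)
    (hc : ∀ v, h ≤ #{w | G.Adj v w ∧ s w ≠ s v}) (hn : n + 2 * w < 2 * h) (f : ℕ) :
    ∀ P : V → V, Function.Involutive P → (∀ v, M v ≠ v → P v = M v) →
    (∀ v, P v = v ∨ P v = M v ∨ (G.Adj v (P v) ∧ s (P v) ≠ s v)) →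
    (∀ b, #{v | P v = v ∧ s v = b} = f) →
    ∃ P' : V → V, Function.Involutive P' ∧ (∀ v, M v ≠ v → P' v = M v) ∧
      (∀ v, P' v = v ∨ P' v = M v ∨ (G.Adj v (P' v) ∧ s (P' v) ≠ s v)) ∧
      ∀ v, P' v ≠ v := by
  induction f with
  | zero =>
    intro P hPi hPM hP hf
    refine ⟨P, hPi, hPM, hP, fun v hv => ?_⟩
    have h1 := hf (s v)
    rw [card_eq_zero] at h1
    have : v ∈ ({u | P u = u ∧ s u = s v} : Finset V) := by simpa using hv
    simp [h1] at this
  | succ f ih =>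
    intro P hPi hPM hP hf
    obtain ⟨a, ha⟩ : Finset.Nonempty ({v | P v = v ∧ s v = true} : Finset V) := by
      rw [← card_pos, hf]; omega
    obtain ⟨b, hb⟩ : Finset.Nonempty ({v | P v = v ∧ s v = false} : Finset V) := by
      rw [← card_pos, hf]; omega
    simp only [mem_filter, mem_univ, true_and] at ha hb
    obtain ⟨P', hPi', hPM', hP', c, hsc, hPc, hfix⟩ := exists_swap_extension hs hw hc hn hPi hPM hP
      ha.1 hb.1 (by simp [ha.2, hb.2])
    refine ih P' hPi' hPM' hP' fun β => ?_
    obtain ⟨d, hd, hdd⟩ : ∃ d, (P d = d ∧ s d = β) ∧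
        ∀ v, (P' v = v ∧ s v = β) ↔ (P v = v ∧ s v = β) ∧ v ≠ d := by
      cases β
      · exact ⟨c, ⟨hPc, hsc.trans hb.2⟩, fun v => by rw [hfix]; grind⟩
      · exact ⟨a, ha, fun v => by rw [hfix]; grind⟩
    have h1 : ({v | P' v = v ∧ s v = β} : Finset V) =
        ({v | P v = v ∧ s v = β} : Finset V).erase d := by
      ext v
      simp only [mem_filter, mem_univ, true_and, mem_erase, hdd]
      tauto
    rw [h1, card_erase_of_mem (by simpa using hd), hf]
    rfl

/-- A small balanced matching inside the sides of a dense balanced bipartition extends to a perfect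
matching by edges across. -/
lemma exists_factor_extending (hs : ∀ b, #{v | s v = b} = n) (hM : Function.Involutive M)
    (hMG : ∀ v, M v ≠ v → G.Adj v (M v))
    (hbal : #{v | M v ≠ v ∧ s v = true} = #{v | M v ≠ v ∧ s v = false})
    (hw : ∀ b, #{v | M v ≠ v ∧ s v = b} ≤ w)
    (hc : ∀ v, h ≤ #{w | G.Adj v w ∧ s w ≠ s v}) (hn : n + 2 * w < 2 * h) :
    ∃ P : V → V, Function.Involutive P ∧ (∀ v, G.Adj v (P v)) ∧ (∀ v, s (P v) = s v → P v = M v) ∧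
      ∀ v, M v ≠ v → P v = M v := by
  have hsplit : ∀ b, #{v | M v = v ∧ s v = b} + #{v | M v ≠ v ∧ s v = b} = n := fun b => by
    rw [← hs b, ← card_filter_add_card_filter_not (s := ({v | s v = b} : Finset V))
      (fun x => M x = x), filter_filter, filter_filter]
    simp only [and_comm, ne_eq]
  obtain ⟨P, hPi, hPM, hP, hfix⟩ := exists_perfect_extension hs hw hc hn
    (#{v | M v = v ∧ s v = true}) M hM (fun _ _ => rfl) (fun _ => Or.inr (Or.inl rfl)) (by
      have h1 := hsplit true
      have h2 := hsplit false
      rintro (_ | _)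
      · omega
      · rfl)
  refine ⟨P, hPi, fun v => ?_, fun v hv => ?_, hPM⟩
  · rcases hP v with h | h | h
    · exact absurd h (hfix v)
    · rw [h]
      exact hMG v (h ▸ hfix v)
    · exact h.1
  · rcases hP v with h | h | h
    · exact absurd h (hfix v)
    · exact h
    · exact absurd hv h.2
end

section
open scoped Classical
variable {V : Type*} [Fintype V]

lemma card_filter_le_of_imp {p q : V → Prop} {_ : DecidablePred p} {_ : DecidablePred q}
    (h : ∀ v, p v → q v) : #{v | p v} ≤ #{v | q v} :=
  card_le_card fun v hv => by
    simp only [mem_filter, mem_univ, true_and] at hv ⊢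
    exact h v hv

/-- Simultaneous discrepancy bound for signed sums. -/
lemma exists_signs {ι : Type*} [Fintype ι] (c : V → ι → ℝ) (hc : ∀ v i, |c v i| ≤ 1) (x : ℝ) :
    ∃ σ : ι → Bool, ∀ v, Real.exp (x * |∑ i, (if σ i then 1 else -1) * c v i|) ≤
      2 * Fintype.card V * Real.exp (x ^ 2 / 2 * Fintype.card ι) := by
  by_contra! hcon
  set X : (ι → Bool) → V → ℝ := fun σ v => ∑ i, (if σ i then 1 else -1) * c v i with hX
  have hone : ∀ (y : ℝ) (v : V), |y| = |x| → ∑ σ : ι → Bool, Real.exp (y * X σ v) ≤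
      2 ^ Fintype.card ι * Real.exp (x ^ 2 / 2 * Fintype.card ι) := by
    intro y v hy
    have h1 : ∀ σ : ι → Bool, Real.exp (y * X σ v) =
        ∏ i, Real.exp (y * ((if σ i then 1 else -1) * c v i)) := fun σ => by
      rw [hX, mul_sum, Real.exp_sum]
    have h2 := Finset.prod_univ_sum (fun _ : ι => (univ : Finset Bool))
      (fun i b => Real.exp (y * ((if b then 1 else -1) * c v i)))
    rw [Fintype.piFinset_univ] at h2
    simp_rw [h1]
    rw [← h2]
    calc _ ≤ ∏ _i : ι, 2 * Real.exp (x ^ 2 / 2) := by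
          refine prod_le_prod (fun i _ => by positivity) fun i _ => ?_
          have h3 : ∑ b : Bool, Real.exp (y * ((if b then 1 else -1) * c v i)) =
              2 * Real.cosh (y * c v i) := by
            rw [Real.cosh_eq]
            simp
            ring
          rw [h3]
          refine mul_le_mul_of_nonneg_left ((Real.cosh_le_exp_half_sq _).trans ?_) two_pos.le
          rw [Real.exp_le_exp]
          have h4 : (c v i) ^ 2 ≤ 1 := by
            rw [sq_le_one_iff_abs_le_one]
            exact hc v i
          have h5 : y ^ 2 = x ^ 2 := (sq_eq_sq_iff_abs_eq_abs y x).2 hy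
          rw [mul_pow, h5]
          nlinarith [sq_nonneg x]
      _ = _ := by
          rw [prod_const, mul_pow, card_univ, ← Real.exp_nat_mul]
          ring_nf
  have hlt : ∑ _σ : ι → Bool, 2 * Fintype.card V * Real.exp (x ^ 2 / 2 * Fintype.card ι) <
      ∑ σ : ι → Bool, ∑ v, (Real.exp (x * X σ v) + Real.exp (-x * X σ v)) := by
    refine sum_lt_sum_of_nonempty univ_nonempty fun σ _ => ?_
    obtain ⟨v, hv⟩ := hcon σ
    refine hv.trans_le (le_trans ?_ (single_le_sum
      (f := fun v => Real.exp (x * X σ v) + Real.exp (-x * X σ v))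
      (fun v _ => by positivity) (mem_univ v)))
    change Real.exp (x * |X σ v|) ≤ Real.exp (x * X σ v) + Real.exp (-x * X σ v)
    rcases abs_choice (X σ v) with h | h <;> rw [h]
    · linarith [Real.exp_pos (-x * X σ v)]
    · rw [mul_neg, ← neg_mul]
      linarith [Real.exp_pos (x * X σ v)]
  rw [sum_comm] at hlt
  refine absurd hlt (not_lt.2 ?_)
  calc _ ≤ ∑ _v : V, (2 ^ Fintype.card ι * Real.exp (x ^ 2 / 2 * Fintype.card ι) +
        2 ^ Fintype.card ι * Real.exp (x ^ 2 / 2 * Fintype.card ι)) := by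
        refine sum_le_sum fun v _ => ?_
        rw [sum_add_distrib]
        exact add_le_add (hone x v rfl) (hone (-x) v (abs_neg x))
    _ = _ := by
        simp
        ring

/-- Every graph of large order `2 * n` has a balanced bipartition which splits every neighbourhood
almost evenly. -/
lemma exists_balanced_split (δ : ℝ) (hδ : 0 < δ) : ∃ N : ℕ, ∀ n ≥ N, ∀ (V : Type*) [Fintype V],
    Fintype.card V = 2 * n → ∀ G : SimpleGraph V, ∃ s : V → Bool, (∀ b, #{v | s v = b} = n) ∧
      ∀ v b, |(#{w | G.Adj v w ∧ s w = b} : ℝ) - (#{w | G.Adj v w} : ℝ) / 2| ≤ δ * n := by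
  refine ⟨⌈8 / δ ^ 4⌉₊, fun n hn V _ hV G => ?_⟩
  have hn' : 8 ≤ δ ^ 4 * n := by
    have := Nat.ceil_le.1 hn
    rwa [div_le_iff₀' (by positivity)] at this
  have e : V ≃ Fin n × Bool := Fintype.equivOfCardEq (by simp [hV, mul_comm])
  obtain ⟨σ, hσ⟩ := exists_signs (fun (v : V) (i : Fin n) =>
    (if G.Adj v (e.symm (i, true)) then 1 else 0) -
      (if G.Adj v (e.symm (i, false)) then (1 : ℝ) else 0))
    (fun v i => by split_ifs <;> simp) δ
  refine ⟨fun v => (σ (e v).1 == (e v).2), fun b => ?_, fun v b => ?_⟩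
  · refine Eq.trans (card_nbij' (t := (univ : Finset (Fin n))) (fun v => (e v).1)
      (fun i => e.symm (i, (σ i == b))) ?_ ?_ ?_ ?_) (by simp)
    · intro v _
      exact mem_univ _
    · intro i _
      simp only [coe_filter, mem_univ, true_and, Set.mem_ofPred_eq, Equiv.apply_symm_apply]
      cases σ i <;> cases b <;> rfl
    · intro v hv
      simp only [coe_filter, mem_univ, true_and, Set.mem_ofPred_eq] at hv
      rw [Equiv.symm_apply_eq]
      ext1
      · rfl
      · subst hv
        cases σ (e v).1 <;> cases (e v).2 <;> rfl
    · intro i _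
      simp
  · set s : V → Bool := fun v => (σ (e v).1 == (e v).2) with hs
    have hsum : ∑ i, (if σ i then 1 else -1) *
        ((if G.Adj v (e.symm (i, true)) then 1 else 0) -
          (if G.Adj v (e.symm (i, false)) then (1 : ℝ) else 0)) =
        (#{w | G.Adj v w ∧ s w = true} : ℝ) - #{w | G.Adj v w ∧ s w = false} := by
      have h1 : ∀ b, (#{w | G.Adj v w ∧ s w = b} : ℝ) = ∑ i, ∑ x : Bool,
          if G.Adj v (e.symm (i, x)) ∧ (σ i == x) = b then (1 : ℝ) else 0 := fun b => by
        rw [← Fintype.sum_prod_type'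
          (f := fun i x => if G.Adj v (e.symm (i, x)) ∧ (σ i == x) = b then (1 : ℝ) else 0),
          ← Equiv.sum_comp e, sum_boole]
        simp [hs]
      rw [h1, h1, ← sum_sub_distrib]
      refine sum_congr rfl fun i _ => ?_
      simp only [Fintype.sum_bool]
      cases σ i <;> simp
    have hadd : (#{w | G.Adj v w ∧ s w = true} : ℝ) + #{w | G.Adj v w ∧ s w = false} =
        #{w | G.Adj v w} := by
      have := card_filter_add_card_filter_not (s := ({w | G.Adj v w} : Finset V))
        (fun w => s w = true)
      simp only [filter_filter, Bool.not_eq_true] at this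
      exact_mod_cast this
    have hlt := hσ v
    rw [hsum, hV, Fintype.card_fin] at hlt
    have hexp : 2 * ((2 * n : ℕ) : ℝ) * Real.exp (δ ^ 2 / 2 * n) ≤ Real.exp (δ * (2 * (δ * n))) := by
      have h2 : (δ * (2 * (δ * n))) = δ ^ 2 / 2 * n + 3 / 2 * δ ^ 2 * n := by ring
      rw [h2, Real.exp_add, mul_comm]
      refine mul_le_mul_of_nonneg_left ?_ (Real.exp_pos _).le
      have h3 := Real.quadratic_le_exp_of_nonneg (x := 3 / 2 * δ ^ 2 * n) (by positivity)
      have h4 : 8 * (n : ℝ) ≤ δ ^ 4 * n * n := mul_le_mul_of_nonneg_right hn' (Nat.cast_nonneg n)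
      have h5 : 0 ≤ 3 / 2 * δ ^ 2 * n := by positivity
      push_cast
      nlinarith
    have h6 := Real.exp_le_exp.1 (hlt.trans hexp)
    have h7 := le_of_mul_le_mul_left h6 hδ
    rw [abs_le] at h7 ⊢
    cases b <;> constructor <;> linarith [h7.1, h7.2]

/-- Repeatedly splitting off an almost balanced bipartite graph and colouring it optimally. -/
lemma exists_partial_edgeColoring_aux {x : ℝ} (hx : 0 ≤ x)
    (hsplit : ∀ G : SimpleGraph V, ∃ s : V → Bool, ∀ v b,
      |(#{w | G.Adj v w ∧ s w = b} : ℝ) - (#{w | G.Adj v w} : ℝ) / 2| ≤ x) (t : ℕ) :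
    ∀ (G : SimpleGraph V) (D : ℝ), 0 ≤ D → (∀ v, (#{w | G.Adj v w} : ℝ) ≤ D) →
    ∃ (k : ℕ) (c : V → V → ℕ), (∀ v w, c v w = c w v) ∧
      (∀ v w w', G.Adj v w → G.Adj v w' → c v w = c v w' → c v w < k → w = w') ∧
      k + ((D - 2 * x) / 2 ^ t + 2 * x) ≤ D + 2 * t * x ∧
      ∀ v, (#{w | G.Adj v w ∧ k ≤ c v w} : ℝ) ≤ (D - 2 * x) / 2 ^ t + 2 * x := by
  induction t with
  | zero =>
    intro G D hD hG
    exact ⟨0, fun _ _ => 0, by simp, by simp, by simp, by simpa using hG⟩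
  | succ t ih =>
    intro G D hD hG
    obtain ⟨s, hs⟩ := hsplit G
    have hs' : ∀ v b, (#{w | G.Adj v w ∧ s w = b} : ℝ) ≤ D / 2 + x := fun v b => by
      have h1 := (abs_le.1 (hs v b)).2
      have h2 := hG v
      linarith
    let B : SimpleGraph V :=
      { Adj := fun v w => G.Adj v w ∧ s v ≠ s w
        symm := ⟨fun _ _ h => ⟨h.1.symm, h.2.symm⟩⟩
        loopless := ⟨fun _ h => h.2 rfl⟩ }
    let G' : SimpleGraph V :=
      { Adj := fun v w => G.Adj v w ∧ s v = s w
        symm := ⟨fun _ _ h => ⟨h.1.symm, h.2.symm⟩⟩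
        loopless := ⟨fun _ h => h.1.ne rfl⟩ }
    have hD1 : 0 ≤ D / 2 + x := by positivity
    obtain ⟨c₁, hc₁s, hc₁k, hc₁⟩ := SimpleGraph.exists_edgeColoring_of_bipartite (G := B) (s := s)
      (k := ⌊D / 2 + x⌋₊) (fun v w h => h.2) (fun v => by
        refine Nat.le_floor (le_trans ?_ (hs' v (!(s v))))
        exact Nat.cast_le.2 (card_filter_le_of_imp fun w h => ⟨h.1, Bool.eq_not.2 (Ne.symm h.2)⟩))
    obtain ⟨k', c', hcs', hc', hk', hdeg'⟩ := ih G' (D / 2 + x) hD1 (fun v => by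
        refine le_trans ?_ (hs' v (s v))
        exact Nat.cast_le.2 (card_filter_le_of_imp fun w h => ⟨h.1, h.2.symm⟩))
    have hfl := Nat.floor_le hD1
    have hL : (D / 2 + x - 2 * x) / 2 ^ t = (D - 2 * x) / 2 ^ (t + 1) := by
      rw [pow_succ]
      field_simp
      ring
    rw [hL] at hk' hdeg'
    refine ⟨⌊D / 2 + x⌋₊ + k', fun v w => if s v = s w then ⌊D / 2 + x⌋₊ + c' v w else c₁ v w,
      ?_, ?_, ?_, ?_⟩
    · intro v w
      simp only [hc₁s v w, hcs' v w, eq_comm (a := s v)]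
    · intro v w w' hw hw' hc hk
      by_cases h1 : s v = s w <;> by_cases h2 : s v = s w' <;> 
        simp only [h1, h2, if_true, if_false] at hc hk
      · simp only [← h1, ← h2, if_true] at hc hk
        exact hc' v w w' ⟨hw, h1⟩ ⟨hw', h2⟩ (by omega) (by omega)
      · have := hc₁k v w' ⟨hw', h2⟩
        grind
      · have := hc₁k v w ⟨hw, h1⟩
        grind
      · exact hc₁ v w w' ⟨hw, h1⟩ ⟨hw', h2⟩ (by grind)
    · push_cast
      linarith
    · intro v
      refine le_trans ?_ (hdeg' v)
      refine Nat.cast_le.2 (card_filter_le_of_imp ?_)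
      rintro w ⟨h1, h2⟩
      by_cases h : s v = s w
      · simp only [h, if_true] at h2
        exact ⟨⟨h1, h⟩, by omega⟩
      · have := hc₁k v w ⟨h1, h⟩
        simp only [h, if_false] at h2
        omega

/-- An asymptotic version of Vizing's theorem: almost `Δ` colours suffice to colour almost all
edges. -/
lemma exists_partial_edgeColoring (η : ℝ) (hη : 0 < η) :
    ∃ N : ℕ, ∀ n ≥ N, ∀ (V : Type*) [Fintype V], Fintype.card V = 2 * n →
    ∀ (G : SimpleGraph V) (D : ℝ), 0 ≤ D →
      (∀ v, (#{w | G.Adj v w} : ℝ) ≤ D) → D ≤ 2 * n →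
    ∃ (k : ℕ) (c : V → V → ℕ), (∀ v w, c v w = c w v) ∧
      (∀ v w w', G.Adj v w → G.Adj v w' → c v w = c v w' → c v w < k → w = w') ∧
      (k : ℝ) ≤ D + η * n ∧ ∀ v, (#{w | G.Adj v w ∧ k ≤ c v w} : ℝ) ≤ η * n := by
  obtain ⟨t, ht⟩ := pow_unbounded_of_one_lt (4 / η) (one_lt_two (α := ℝ))
  obtain ⟨N, hN⟩ := exists_balanced_split (η / (2 * t + 4)) (by positivity)
  refine ⟨N, fun n hn V _ hV G D hD hG hDn => ?_⟩
  set x : ℝ := η / (2 * t + 4) * n with hx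
  have hx0 : 0 ≤ x := by positivity
  have hxt : (2 * t + 4) * x = η * n := by
    rw [hx]
    field_simp
  obtain ⟨k, c, hcs, hc, hk, hdeg⟩ := exists_partial_edgeColoring_aux hx0
    (fun G => (hN n hn V hV G).imp fun s hs => hs.2) t G D hD hG
  have h2t : (1 : ℝ) ≤ 2 ^ t := one_le_pow₀ one_le_two
  have h1 : (D - 2 * x) / 2 ^ t ≤ η * n / 2 := by
    rw [div_lt_iff₀ hη] at ht
    rw [div_le_iff₀ (by positivity)]
    have : (4 : ℝ) * n ≤ 2 ^ t * η * n := mul_le_mul_of_nonneg_right ht.le (Nat.cast_nonneg n)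
    linarith
  have h2 : -(2 * x) ≤ (D - 2 * x) / 2 ^ t := by
    rw [le_div_iff₀ (by positivity)]
    nlinarith
  have h3 : 4 * x ≤ η * n := by
    rw [← hxt]
    have : 0 ≤ (t : ℝ) * x := by positivity
    linarith
  exact ⟨k, c, hcs, hc, by linarith, fun v => (hdeg v).trans (by linarith)⟩
end

/-- A family of pairwise disjoint matchings of `G` indexed by `I`, inside the sides of `s`; a vertex
is fixed by `M i` when the `i`-th matching misses it. -/
structure IsMatchingFamily {V : Type*} (G : SimpleGraph V) (s : V → Bool) (M : ℕ → V → V)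
    (I : Finset ℕ) : Prop where
  involutive : ∀ i ∈ I, Function.Involutive (M i)
  side : ∀ i ∈ I, ∀ v, s (M i v) = s v
  adj : ∀ i ∈ I, ∀ v, M i v ≠ v → G.Adj v (M i v)
  disjoint : ∀ i ∈ I, ∀ j ∈ I, ∀ v, M i v = M j v → M i v ≠ v → i = j

/-- The edges of `G` inside a side of `s` which lie in none of the matchings `M i`, `i ∈ I`. -/
def IsUncovered {V : Type*} (G : SimpleGraph V) (s : V → Bool) (M : ℕ → V → V)
    (I : Finset ℕ) (v w : V) : Prop :=
  G.Adj v w ∧ s w = s v ∧ ∀ i ∈ I, M i v ≠ w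

section
variable {V : Type*} {G : SimpleGraph V} {s : V → Bool} {M : ℕ → V → V} {P : V → V}
  {I : Finset ℕ} {i : ℕ}

lemma IsMatchingFamily.removeMatching (hi : i ∉ I) (h : IsMatchingFamily G s M (insert i I))
    (hP : Function.Involutive P) (hPM : ∀ v, s (P v) = s v → P v = M i v) :
    IsMatchingFamily (G.removeMatching P) s M I where
  involutive j hj := h.involutive j (mem_insert_of_mem hj)
  side j hj := h.side j (mem_insert_of_mem hj)
  adj j hj v hv := by
    refine (SimpleGraph.removeMatching_adj hP).2 ⟨h.adj j (mem_insert_of_mem hj) v hv, fun hv' => hi ?_⟩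
    have h1 : s (P v) = s v := by rw [hv', h.side j (mem_insert_of_mem hj)]
    have h2 := hPM v h1
    rwa [h.disjoint i (mem_insert_self i I) j (mem_insert_of_mem hj) v (h2.symm.trans hv')
      (by rw [← h2, hv']; exact hv)]
  disjoint j hj k hk := h.disjoint j (mem_insert_of_mem hj) k (mem_insert_of_mem hk)

lemma IsUncovered.of_removeMatching (hP : Function.Involutive P) {v x : V}
    (h : IsUncovered (G.removeMatching P) s M I v x) :
    IsUncovered G s M (insert i I) v x ∨ x = M i v ∧ M i v ≠ v ∧ P v ≠ M i v := by
  obtain ⟨h1, h2, h3⟩ := h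
  rw [SimpleGraph.removeMatching_adj hP] at h1
  by_cases hx : M i v = x
  · exact .inr ⟨hx.symm, by rw [hx]; exact h1.1.ne.symm, by rw [hx]; exact h1.2⟩
  · refine .inl ⟨h1.1, h2, fun j hj => ?_⟩
    rcases mem_insert.1 hj with rfl | hj
    · exact hx
    · exact h3 j hj
end

section
open scoped Classical
variable {V : Type*} [Fintype V] {G : SimpleGraph V} {s : V → Bool} {M : ℕ → V → V} {P : V → V}
  {I : Finset ℕ} {n c m w i : ℕ}

lemma degree_le_card_across_add (v : V) : #{w | G.Adj v w} ≤
    #{w | G.Adj v w ∧ s w ≠ s v} + #{w | IsUncovered G s M I v w} + #I := by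
  calc #{w | G.Adj v w} ≤ #(((univ : Finset V).filter (fun w => G.Adj v w ∧ s w ≠ s v) ∪
        univ.filter (IsUncovered G s M I v)) ∪ I.image fun i => M i v) := by
        refine card_le_card fun w hw => ?_
        simp only [mem_filter, mem_univ, true_and, mem_union, mem_image, IsUncovered] at hw ⊢
        by_cases h : s w = s v
        · by_cases h' : ∃ i ∈ I, M i v = w
          · exact .inr h'
          · push Not at h'
            exact .inl (.inr ⟨hw, h, h'⟩)
        · exact .inl (.inl ⟨hw, h⟩)
    _ ≤ _ := (card_union_le _ _).trans (add_le_add (card_union_le _ _) card_image_le)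

lemma card_isUncovered_removeMatching_le (hP : Function.Involutive P) (i : ℕ) (v : V) :
    #{x | IsUncovered (G.removeMatching P) s M I v x} ≤
      #{x | IsUncovered G s M (insert i I) v x} + if M i v ≠ v ∧ P v ≠ M i v then 1 else 0 := by
  calc _ ≤ #(univ.filter (IsUncovered G s M (insert i I) v) ∪
        if M i v ≠ v ∧ P v ≠ M i v then {M i v} else ∅) := by
        refine card_le_card fun x hx => ?_
        rw [mem_union, mem_filter]
        rcases IsUncovered.of_removeMatching (i := i) hP (mem_filter.1 hx).2 with h | ⟨rfl, h⟩
        · exact .inl ⟨mem_univ _, h⟩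
        · right
          rw [if_pos h]
          exact mem_singleton_self _
    _ ≤ _ := by
        refine (card_union_le _ _).trans (Nat.add_le_add_left ?_ _)
        split_ifs <;> simp

/-- Extending nearly perfect matchings to perfect matchings one after the other. -/
lemma oneFactorizable_of_nearly_perfect (hs : ∀ b, #{v | s v = b} = n) {κ σ : ℕ}
    (hn : n + 5 * m + 2 * σ + 2 * κ < 2 * c)
    (hend : ∀ G : SimpleGraph V, (∀ v, #{w | G.Adj v w} = c) →
      (∀ v, #{w | G.Adj v w ∧ s w = s v} ≤ κ) → G.OneFactorizable) :
    ∀ G : SimpleGraph V, IsMatchingFamily G s M I → (∀ v, #{w | G.Adj v w} = #I + c) →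
      (∀ i ∈ I, #{v | M i v = v} ≤ m) → (∀ v, #{w | IsUncovered G s M I v w} ≤ κ) →
      (∑ v, #{w | IsUncovered G s M I v w} + #I * (4 * m) < (σ + 1) * κ) →
      G.OneFactorizable := by
  induction I using Finset.induction with
  | empty =>
    intro G _ hdeg _ hκ _
    refine hend G (fun v => by simpa using hdeg v) fun v => ?_
    simpa [IsUncovered] using hκ v
  | insert i I hi ih =>
    intro G hfam hdeg hm hκ hsum
    set S : Finset V := {v | κ ≤ #{w | IsUncovered G s M (insert i I) v w}} with hSdef
    have hS : #S ≤ σ := by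
      have h1 : #S * κ ≤ ∑ v, #{w | IsUncovered G s M (insert i I) v w} := by
        rw [← smul_eq_mul]
        exact (card_nsmul_le_sum S _ κ fun v hv => (mem_filter.1 hv).2).trans
          (sum_le_sum_of_subset (subset_univ _))
      have h2 : #S * κ < (σ + 1) * κ := by omega
      exact Nat.lt_succ_iff.1 (lt_of_mul_lt_mul_right h2 (Nat.zero_le _))
    have hii := mem_insert_self i I
    obtain ⟨P, hP, hPG, hPM, hPS, hPm⟩ := exists_factor_of_matching (h := c - κ) hs
      (hfam.involutive i hii) (hfam.side i hii) (hfam.adj i hii) (hm i hii) hS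
      (fun v => by
        have h1 := degree_le_card_across_add (G := G) (s := s) (M := M) (I := insert i I) v
        have h2 := hdeg v
        have h3 := hκ v
        omega) (by omega)
    rw [card_insert_of_notMem hi] at hdeg hsum
    refine SimpleGraph.OneFactorizable.of_removeMatching hP hPG (ih _
      (hfam.removeMatching hi hP hPM) (fun v => ?_) (fun j hj => hm j (mem_insert_of_mem hj))
      (fun v => ?_) ?_)
    · have h1 := SimpleGraph.card_removeMatching hP hPG v
      have h2 := hdeg v
      omega
    · refine (card_isUncovered_removeMatching_le hP i v).trans ?_
      by_cases hv : v ∈ S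
      · rw [if_neg fun h => h.2 (hPS v hv h.1)]
        exact hκ v
      · have : #{w | IsUncovered G s M (insert i I) v w} < κ := by
          simpa [hSdef] using hv
        split_ifs <;> omega
    · have h1 : ∑ v, #{x | IsUncovered (G.removeMatching P) s M I v x} ≤
          ∑ v, #{x | IsUncovered G s M (insert i I) v x} + 4 * m := by
        refine (sum_le_sum fun v _ => card_isUncovered_removeMatching_le hP i v).trans ?_
        rw [sum_add_distrib, ← card_filter]
        refine Nat.add_le_add_left (le_trans (card_filter_le_of_imp fun v hv => hv.2) hPm) _
      nlinarith

/-- Extending small balanced matchings to perfect matchings one after the other. -/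
lemma oneFactorizable_of_balanced (hs : ∀ b, #{v | s v = b} = n) (hn : n + 2 * w < 2 * c) :
    ∀ G : SimpleGraph V, IsMatchingFamily G s M I → (∀ v, #{w | G.Adj v w} = #I + c) →
      (∀ i ∈ I, #{v | M i v ≠ v ∧ s v = true} = #{v | M i v ≠ v ∧ s v = false}) →
      (∀ i ∈ I, ∀ b, #{v | M i v ≠ v ∧ s v = b} ≤ w) → (∀ v x, ¬ IsUncovered G s M I v x) →
      G.OneFactorizable := by
  induction I using Finset.induction with
  | empty =>
    intro G _ hdeg _ _ hunc
    refine SimpleGraph.oneFactorizable_of_bipartite c G (s := s) (fun v x h hsv => ?_)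
      fun v => by simpa using hdeg v
    exact hunc v x ⟨h, hsv.symm, by simp⟩
  | insert i I hi ih =>
    intro G hfam hdeg hbal hw hunc
    have hii := mem_insert_self i I
    obtain ⟨P, hP, hPG, hPM, hPE⟩ := exists_factor_extending (h := c) hs
      (hfam.involutive i hii) (hfam.adj i hii) (hbal i hii) (hw i hii)
      (fun v => by
        have h1 := degree_le_card_across_add (G := G) (s := s) (M := M) (I := insert i I) v
        have h2 := hdeg v
        simp only [hunc, filter_false, card_empty] at h1
        omega) hn
    rw [card_insert_of_notMem hi] at hdeg
    refine SimpleGraph.OneFactorizable.of_removeMatching hP hPG (ih _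
      (hfam.removeMatching hi hP hPM) (fun v => ?_) (fun j hj => hbal j (mem_insert_of_mem hj))
      (fun j hj => hw j (mem_insert_of_mem hj)) fun v x hx => ?_)
    · have h1 := SimpleGraph.card_removeMatching hP hPG v
      have h2 := hdeg v
      omega
    · rcases hx.of_removeMatching (i := i) hP with h | ⟨-, h1, h2⟩
      · exact hunc v x h
      · exact h2 (hPE v h1)
end

section
open scoped Classical

/-- The matching `N` together with the edge joining `a` and `b`. -/
noncomputable def addEdge {V : Type*} (N : V → V) (a b v : V) : V :=
  if v = a then b else if v = b then a else N v

section
variable {V : Type*} {G : SimpleGraph V} {s : V → Bool} {M : ℕ → V → V} {N : V → V}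
  {I : Finset ℕ} {i : ℕ} {a b v x : V}

lemma addEdge_involutive (hN : Function.Involutive N) (ha : N a = a) (hb : N b = b) :
    Function.Involutive (addEdge N a b) := by
  intro v
  have h1 := hN v
  unfold addEdge
  grind

lemma IsMatchingFamily.addEdge (h : IsMatchingFamily G s M I) (hi : i ∈ I)
    (hab : IsUncovered G s M I a b) (ha : M i a = a) (hb : M i b = b) :
    IsMatchingFamily G s (Function.update M i (addEdge (M i) a b)) I := by
  have hba : ∀ j ∈ I, M j b ≠ a := fun j hj hj' => hab.2.2 j hj (by rw [← hj', h.involutive j hj])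
  have hupd : ∀ j v, Function.update M i (_root_.addEdge (M i) a b) j v = M j v ∨
      j = i ∧ (v = a ∧ Function.update M i (_root_.addEdge (M i) a b) j v = b ∨
        v = b ∧ Function.update M i (_root_.addEdge (M i) a b) j v = a) := by
    intro j v
    by_cases hj : j = i
    · subst hj
      rw [Function.update_self]
      unfold _root_.addEdge
      grind
    · rw [Function.update_of_ne hj]
      exact .inl rfl
  refine ⟨fun j hj => ?_, fun j hj v => ?_, fun j hj v hv => ?_, fun j hj k hk v hv hv' => ?_⟩
  · by_cases hji : j = i
    · subst hji
      rw [Function.update_self]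
      exact addEdge_involutive (h.involutive j hj) ha hb
    · rw [Function.update_of_ne hji]
      exact h.involutive j hj
  · rcases hupd j v with h1 | ⟨-, ⟨h2, h1⟩ | ⟨h2, h1⟩⟩ <;> rw [h1]
    · exact h.side j hj v
    · rw [h2]
      exact hab.2.1
    · rw [h2]
      exact hab.2.1.symm
  · rcases hupd j v with h1 | ⟨-, ⟨h2, h1⟩ | ⟨h2, h1⟩⟩ <;> rw [h1]
    · exact h.adj j hj v (by rwa [← h1])
    · rw [h2]
      exact hab.1
    · rw [h2]
      exact hab.1.symm
  · have h3 := h.disjoint j hj k hk v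
    have h4 := hab.2.2 j hj
    have h5 := hab.2.2 k hk
    have h6 := hba j hj
    have h7 := hba k hk
    rcases hupd j v with h1 | ⟨h0, ⟨h2, h1⟩ | ⟨h2, h1⟩⟩ <;>
    rcases hupd k v with h1' | ⟨h0', ⟨h2', h1'⟩ | ⟨h2', h1'⟩⟩ <;>
    rw [h1] at hv hv' <;> rw [h1'] at hv <;> grind

lemma IsUncovered.of_addEdge (ha : M i a = a) (hb : M i b = b)
    (h : IsUncovered G s (Function.update M i (addEdge (M i) a b)) I v x) :
    IsUncovered G s M I v x := by
  refine ⟨h.1, h.2.1, fun j hj hjv => ?_⟩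
  have h1 := h.2.2 j hj
  have h2 := h.1.ne
  by_cases hji : j = i
  · subst hji
    rw [Function.update_self] at h1
    unfold addEdge at h1
    grind
  · rw [Function.update_of_ne hji] at h1
    exact h1 hjv

lemma IsUncovered.addEdge (h : IsUncovered G s M I v x) (ha : v ≠ a) (hb : v ≠ b) :
    IsUncovered G s (Function.update M i (addEdge (M i) a b)) I v x := by
  refine ⟨h.1, h.2.1, fun j hj => ?_⟩
  by_cases hji : j = i
  · subst hji
    rw [Function.update_self, _root_.addEdge, if_neg ha, if_neg hb]
    exact h.2.2 j hj
  · rw [Function.update_of_ne hji]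
    exact h.2.2 j hj

lemma card_moved_addEdge [Fintype V] (hab : a ≠ b) (hs : s b = s a) (ha : N a = a) (hb : N b = b)
    (β : Bool) : #{v | addEdge N a b v ≠ v ∧ s v = β} =
      #{v | N v ≠ v ∧ s v = β} + if s a = β then 2 else 0 := by
  have h : univ.filter (fun v => addEdge N a b v ≠ v ∧ s v = β) =
      univ.filter (fun v => N v ≠ v ∧ s v = β) ∪ if s a = β then {a, b} else ∅ := by
    ext v
    unfold addEdge
    split_ifs <;> simp <;> grind
  rw [h, card_union_of_disjoint]
  · split_ifs
    · rw [card_pair hab]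
    · rfl
  · rw [disjoint_left]
    intro v hv
    split_ifs <;> simp at hv ⊢
    grind
end

section
variable {V : Type*} [Fintype V] {G : SimpleGraph V} {s : V → Bool} {M : ℕ → V → V}
  {I : Finset ℕ} {n d w κ q : ℕ}

lemma IsMatchingFamily.card_inside (h : IsMatchingFamily G s M I) (v : V) :
    #{x | G.Adj v x ∧ s x = s v} = #{x | IsUncovered G s M I v x} + #{i ∈ I | M i v ≠ v} := by
  have h1 : #{i ∈ I | M i v ≠ v} = #((I.filter fun i => M i v ≠ v).image fun i => M i v) := by
    refine (card_image_of_injOn fun i hi j hj hij => ?_).symm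
    simp only [coe_filter, Set.mem_ofPred_eq] at hi hj
    exact h.disjoint i hi.1 j hj.1 v hij hi.2
  rw [h1, ← card_union_of_disjoint]
  · congr 1
    ext x
    simp only [mem_filter, mem_univ, true_and, mem_union, mem_image]
    constructor
    · rintro ⟨h2, h3⟩
      by_cases hx : ∃ i ∈ I, M i v = x
      · obtain ⟨i, hi, rfl⟩ := hx
        exact .inr ⟨i, ⟨hi, h2.ne.symm⟩, rfl⟩
      · push Not at hx
        exact .inl ⟨h2, h3, hx⟩
    · rintro (h2 | ⟨i, ⟨hi, h2⟩, rfl⟩)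
      · exact ⟨h2.1, h2.2.1⟩
      · exact ⟨h.adj i hi v h2, h.side i hi v⟩
  · rw [disjoint_left]
    intro x hx hx'
    simp only [mem_filter, mem_univ, true_and, mem_image] at hx hx'
    obtain ⟨i, ⟨hi, -⟩, h3⟩ := hx'
    exact hx.2.2 i hi h3

lemma sum_card_across_eq : ∑ v with s v = true, #{x | G.Adj v x ∧ s x ≠ s v} =
    ∑ v with s v = false, #{x | G.Adj v x ∧ s x ≠ s v} := by
  simp only [card_filter, sum_filter]
  have h : ∀ b v, (if s v = b then ∑ x, (if G.Adj v x ∧ s x ≠ s v then 1 else 0) else 0) =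
      ∑ x, if G.Adj v x ∧ s v = b ∧ s x = !b then 1 else 0 := by
    intro b v
    split_ifs with h
    · refine sum_congr rfl fun x _ => if_congr ?_ rfl rfl
      cases b <;> simp [h]
    · simp [h]
  simp_rw [h]
  rw [sum_comm]
  refine sum_congr rfl fun v _ => sum_congr rfl fun x _ => if_congr ?_ rfl rfl
  simp [SimpleGraph.adj_comm, and_comm]

lemma sum_card_inside_eq (hs : ∀ b, #{v | s v = b} = n) (hd : ∀ v, #{x | G.Adj v x} = d) :
    ∑ v with s v = true, #{x | G.Adj v x ∧ s x = s v} =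
      ∑ v with s v = false, #{x | G.Adj v x ∧ s x = s v} := by
  have h : ∀ b, ∑ v with s v = b, #{x | G.Adj v x ∧ s x = s v} +
      ∑ v with s v = b, #{x | G.Adj v x ∧ s x ≠ s v} = n * d := fun b => by
    rw [← sum_add_distrib, ← hs b, ← smul_eq_mul, ← sum_const]
    refine sum_congr rfl fun v _ => ?_
    rw [← hd v, ← filter_filter, ← filter_filter, card_filter_add_card_filter_not]
  have h1 := h true
  have h2 := h false
  have h3 := sum_card_across_eq (G := G) (s := s)
  omega

lemma sum_card_moved (b : Bool) : ∑ v with s v = b, #{i ∈ I | M i v ≠ v} =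
    ∑ i ∈ I, #{v | M i v ≠ v ∧ s v = b} := by
  simp only [card_filter]
  rw [sum_comm]
  refine sum_congr rfl fun i _ => ?_
  rw [sum_filter]
  refine sum_congr rfl fun v _ => ?_
  split_ifs <;> simp_all

lemma exists_add_pair (hs : ∀ b, #{v | s v = b} = n) (hd : ∀ v, #{x | G.Adj v x} = d)
    (hκ : ∀ v, #{x | G.Adj v x ∧ s x = s v} ≤ κ) (hq : 4 * κ * w + n * κ < q * w)
    (hM : IsMatchingFamily G s M (range q))
    (hbal : ∀ i ∈ range q, #{v | M i v ≠ v ∧ s v = true} = #{v | M i v ≠ v ∧ s v = false})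
    (hw : ∀ i ∈ range q, ∀ b, #{v | M i v ≠ v ∧ s v = b} ≤ w + 1)
    (hunc : ∃ v x, IsUncovered G s M (range q) v x) :
    ∃ M' : ℕ → V → V, IsMatchingFamily G s M' (range q) ∧
      (∀ i ∈ range q, #{v | M' i v ≠ v ∧ s v = true} = #{v | M' i v ≠ v ∧ s v = false}) ∧
      (∀ i ∈ range q, ∀ b, #{v | M' i v ≠ v ∧ s v = b} ≤ w + 1) ∧
      #{p : V × V | IsUncovered G s M' (range q) p.1 p.2} <
        #{p : V × V | IsUncovered G s M (range q) p.1 p.2} := by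
  have hpair : ∀ b, ∃ v x, s v = b ∧ IsUncovered G s M (range q) v x := by
    have h1 : ∀ b, ∑ v with s v = b, #{x | G.Adj v x ∧ s x = s v} =
        ∑ v with s v = b, #{x | IsUncovered G s M (range q) v x} +
          ∑ i ∈ range q, #{v | M i v ≠ v ∧ s v = b} := fun b => by
      rw [← sum_card_moved, ← sum_add_distrib]
      exact sum_congr rfl fun v _ => hM.card_inside v
    have h2 := sum_card_inside_eq (G := G) hs hd
    rw [h1, h1, sum_congr rfl hbal] at h2
    have h3 : ∀ b, 0 < ∑ v with s v = b, #{x | IsUncovered G s M (range q) v x} ↔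
        ∃ v x, s v = b ∧ IsUncovered G s M (range q) v x := fun b => by
      simp [Nat.pos_iff_ne_zero, card_eq_zero, filter_eq_empty_iff]
    obtain ⟨v, x, hvx⟩ := hunc
    have h4 := (h3 (s v)).2 ⟨v, x, rfl, hvx⟩
    have h5 : ∀ b, 0 < ∑ v with s v = b, #{x | IsUncovered G s M (range q) v x} := by
      cases hsv : s v <;> rw [hsv] at h4 <;> rintro (_ | _) <;> omega
    exact fun b => (h3 b).1 (h5 b)
  obtain ⟨a, a', hsa, ha⟩ := hpair true
  obtain ⟨b, b', hsb, hb⟩ := hpair false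
  have hmoved : ∀ v, #{i ∈ range q | M i v ≠ v} ≤ κ := fun v => by
    have := hM.card_inside v
    have := hκ v
    omega
  obtain ⟨i, hi, hia, hia', hib, hib', hiw⟩ : ∃ i ∈ range q, M i a = a ∧ M i a' = a' ∧ M i b = b ∧
      M i b' = b' ∧ #{v | M i v ≠ v ∧ s v = true} < w := by
    by_contra! hcon
    have hfull : #{i ∈ range q | w ≤ #{v | M i v ≠ v ∧ s v = true}} * w ≤ n * κ := by
      calc _ ≤ ∑ i ∈ range q, #{v | M i v ≠ v ∧ s v = true} := by
            rw [← smul_eq_mul]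
            exact (card_nsmul_le_sum _ _ w fun i hi => (mem_filter.1 hi).2).trans
              (sum_le_sum_of_subset (filter_subset _ _))
        _ ≤ _ := by
            rw [← sum_card_moved, ← hs true, ← smul_eq_mul]
            exact sum_le_card_nsmul _ _ _ fun v _ => hmoved v
    have hcover : range q ⊆ (((range q).filter (fun i => M i a ≠ a) ∪
        (range q).filter (fun i => M i a' ≠ a')) ∪ ((range q).filter (fun i => M i b ≠ b) ∪
        (range q).filter (fun i => M i b' ≠ b'))) ∪
        (range q).filter (fun i => w ≤ #{v | M i v ≠ v ∧ s v = true}) := by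
      intro i hi
      have := hcon i hi
      simp only [mem_union, mem_filter, hi, true_and]
      tauto
    have h1 := card_le_card hcover
    rw [card_range] at h1
    have h2 : q ≤ 4 * κ + #{i ∈ range q | w ≤ #{v | M i v ≠ v ∧ s v = true}} := by
      refine h1.trans ((card_union_le _ _).trans (Nat.add_le_add_right ?_ _))
      refine (card_union_le _ _).trans ((add_le_add (card_union_le _ _) (card_union_le _ _)).trans ?_)
      have := hmoved a
      have := hmoved a'
      have := hmoved b
      have := hmoved b'
      omega
    have h3 := Nat.mul_le_mul_right w h2
    rw [add_mul] at h3
    omega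
  have hba : b ≠ a := fun h => by simp [h, hsa] at hsb
  have hba' : b ≠ a' := fun h => by simp [h, ha.2.1, hsa] at hsb
  have hne₁ : b' ≠ a := fun h => by
    have := hb.2.1
    simp [h, hsa, hsb] at this
  have hne₂ : b' ≠ a' := fun h => by
    have := hb.2.1
    simp [h, ha.2.1, hsa, hsb] at this
  set M₁ := Function.update M i (addEdge (M i) a a') with hM₁
  have hM₁i : M₁ i = addEdge (M i) a a' := Function.update_self ..
  have hb₁ : M₁ i b = b := by simp [hM₁i, addEdge, hba, hba', hib]
  have hb₁' : M₁ i b' = b' := by simp [hM₁i, addEdge, hne₁, hne₂, hib']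
  have hfam := hM.addEdge hi ha hia hia'
  have hb₂ : IsUncovered G s M₁ (range q) b b' := hb.addEdge hba hba'
  set M₂ := Function.update M₁ i (addEdge (M₁ i) b b') with hM₂
  have hM₂i : M₂ i = addEdge (M₁ i) b b' := Function.update_self ..
  have hcount : ∀ β, #{v | M₂ i v ≠ v ∧ s v = β} = #{v | M i v ≠ v ∧ s v = β} + 2 := fun β => by
    rw [hM₂i, card_moved_addEdge hb₂.1.ne hb₂.2.1 hb₁ hb₁', hM₁i,
      card_moved_addEdge ha.1.ne ha.2.1 hia hia', hsa, hsb]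
    cases β <;> simp
  have hother : ∀ j, j ≠ i → M₂ j = M j := fun j hj => by
    rw [hM₂, Function.update_of_ne hj, hM₁, Function.update_of_ne hj]
  refine ⟨M₂, hfam.addEdge hi hb₂ hb₁ hb₁', fun j hj => ?_, fun j hj β => ?_, ?_⟩
  · by_cases hji : j = i
    · rw [hji, hcount, hcount, hbal i hi]
    · rw [hother j hji]
      exact hbal j hj
  · by_cases hji : j = i
    · rw [hji, hcount]
      have := hbal i hi
      cases β <;> omega
    · rw [hother j hji]
      exact hw j hj β
  · refine card_lt_card ⟨fun p hp => ?_, fun hsub => ?_⟩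
    · simp only [mem_filter, mem_univ, true_and] at hp ⊢
      exact (hp.of_addEdge hb₁ hb₁').of_addEdge hia hia'
    · have h1 : (b, b') ∈ univ.filter fun p : V × V => IsUncovered G s M₂ (range q) p.1 p.2 :=
        hsub (by simpa using hb)
      simp only [mem_filter, mem_univ, true_and] at h1
      exact h1.2.2 i hi (by simp [hM₂i, addEdge])

/-- A sparse graph inside the two sides of a balanced bipartition of a regular graph decomposes into
few small matchings with equally many edges in both sides. -/
lemma exists_balanced_matchingFamily (hs : ∀ b, #{v | s v = b} = n) (hd : ∀ v, #{x | G.Adj v x} = d)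
    (hκ : ∀ v, #{x | G.Adj v x ∧ s x = s v} ≤ κ) (hq : 4 * κ * w + n * κ < q * w) :
    ∃ M : ℕ → V → V, IsMatchingFamily G s M (range q) ∧
      (∀ i ∈ range q, #{v | M i v ≠ v ∧ s v = true} = #{v | M i v ≠ v ∧ s v = false}) ∧
      (∀ i ∈ range q, ∀ b, #{v | M i v ≠ v ∧ s v = b} ≤ w + 1) ∧
      ∀ v x, ¬ IsUncovered G s M (range q) v x := by
  suffices h : ∀ t, ∀ M : ℕ → V → V, IsMatchingFamily G s M (range q) →
      (∀ i ∈ range q, #{v | M i v ≠ v ∧ s v = true} = #{v | M i v ≠ v ∧ s v = false}) →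
      (∀ i ∈ range q, ∀ b, #{v | M i v ≠ v ∧ s v = b} ≤ w + 1) →
      #{p : V × V | IsUncovered G s M (range q) p.1 p.2} ≤ t →
      ∃ M : ℕ → V → V, IsMatchingFamily G s M (range q) ∧
      (∀ i ∈ range q, #{v | M i v ≠ v ∧ s v = true} = #{v | M i v ≠ v ∧ s v = false}) ∧
      (∀ i ∈ range q, ∀ b, #{v | M i v ≠ v ∧ s v = b} ≤ w + 1) ∧
      ∀ v x, ¬ IsUncovered G s M (range q) v x from
    h _ (fun _ => id) ⟨fun _ _ _ => rfl, fun _ _ _ => rfl, fun _ _ _ h => absurd rfl h,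
      fun _ _ _ _ _ _ h => absurd rfl h⟩ (by simp) (by simp) le_rfl
  intro t
  induction t with
  | zero =>
    intro M hM hbal hw ht
    refine ⟨M, hM, hbal, hw, fun v x hvx => ?_⟩
    rw [Nat.le_zero, card_eq_zero, filter_eq_empty_iff] at ht
    exact ht (mem_univ (v, x)) hvx
  | succ t ih =>
    intro M hM hbal hw ht
    by_cases hunc : ∃ v x, IsUncovered G s M (range q) v x
    · obtain ⟨M', hM', hbal', hw', hlt⟩ := exists_add_pair hs hd hκ hq hM hbal hw hunc
      exact ih M' hM' hbal' hw' (by omega)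
    · push Not at hunc
      exact ⟨M, hM, hbal, hw, hunc⟩

/-- A regular graph with a balanced bipartition which is almost bipartite is 1-factorizable. -/
lemma oneFactorizable_of_sparse_inside (hs : ∀ b, #{v | s v = b} = n)
    (hd : ∀ v, #{x | G.Adj v x} = d) (hκ : ∀ v, #{x | G.Adj v x ∧ s x = s v} ≤ κ)
    (hq : 4 * κ * w + n * κ < q * w) (hn : n + 2 * w + 2 + 2 * q < 2 * d) :
    G.OneFactorizable := by
  obtain ⟨M, hM, hbal, hw, hunc⟩ := exists_balanced_matchingFamily hs hd hκ hq
  refine oneFactorizable_of_balanced (w := w + 1) (c := d - q) hs (by omega) G hM (fun v => ?_) hbal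
    hw hunc
  rw [hd, card_range]
  omega
end
end

section
open scoped Classical
variable {V : Type*} [Fintype V] {G : SimpleGraph V} {s : V → Bool} {c : V → V → ℕ}
  {n d k m D L X β κ w q : ℕ}

/-- The colour classes of a partial edge colouring inside the sides of `s`. -/
lemma exists_matchingFamily_of_coloring (hc : ∀ v x, c v x = c x v)
    (hcp : ∀ v x y, G.Adj v x → s x = s v → G.Adj v y → s y = s v → c v x = c v y → c v x < k →
      x = y) : ∃ M : ℕ → V → V, IsMatchingFamily G s M (range k) ∧
      ∀ v x, IsUncovered G s M (range k) v x → k ≤ c v x := by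
  choose M hM hM' using fun (i : ℕ) (v : V) => show ∃ x : V,
      (x ≠ v → G.Adj v x ∧ s x = s v ∧ c v x = i) ∧
      (x = v → ∀ y, G.Adj v y → s y = s v → c v y ≠ i) by
    by_cases h : ∃ x, G.Adj v x ∧ s x = s v ∧ c v x = i
    · obtain ⟨x, hx⟩ := h
      exact ⟨x, fun _ => hx, fun h => absurd h hx.1.ne.symm⟩
    · push Not at h
      exact ⟨v, fun h => absurd rfl h, fun _ => h⟩
  have hMeq : ∀ v x, G.Adj v x → s x = s v → c v x < k → M (c v x) v = x := by
    intro v x h1 h2 h3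
    by_cases h : M (c v x) v = v
    · exact absurd rfl (hM' _ v h x h1 h2)
    · obtain ⟨h4, h5, h6⟩ := hM _ v h
      exact hcp v _ _ h4 h5 h1 h2 h6 (by omega)
  refine ⟨M, ⟨fun i hi v => ?_, fun i hi v => ?_, fun i hi v hv => (hM i v hv).1,
    fun i hi j hj v hij hv => ?_⟩, fun v x hvx => ?_⟩
  · by_cases h : M i v = v
    · rw [h, h]
    · obtain ⟨h1, h2, h3⟩ := hM i v h
      have h4 := hMeq _ _ h1.symm h2.symm (by rw [hc, h3]; exact mem_range.1 hi)
      rwa [hc, h3] at h4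
  · by_cases h : M i v = v
    · rw [h]
    · exact (hM i v h).2.1
  · rw [← (hM i v hv).2.2, hij, (hM j v (hij ▸ hv)).2.2]
  · by_contra! h
    exact hvx.2.2 _ (mem_range.2 h) (hMeq v x hvx.1 hvx.2.1 h)

lemma oneFactorizable_of_coloring (hs : ∀ b, #{v | s v = b} = n) (hd : ∀ v, #{x | G.Adj v x} = d)
    (hc : ∀ v x, c v x = c x v)
    (hcp : ∀ v x y, G.Adj v x → s x = s v → G.Adj v y → s y = s v → c v x = c v y → c v x < k →
      x = y)
    (hD : ∀ v, D ≤ #{x | G.Adj v x ∧ s x = s v})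
    (hL : ∀ v, #{x | (G.Adj v x ∧ s x = s v) ∧ k ≤ c v x} ≤ L) (hX : k + L ≤ D + X)
    (hβ : 2 * n * X < (m + 1) * (β + 1)) (hκ : L + β ≤ κ)
    (hT : 2 * n * (L + β) + k * (4 * m) < (κ + 1) * κ) (hm : n + 5 * m + 4 * κ + 2 * k < 2 * d)
    (hq : 4 * κ * w + n * κ < q * w) (hn : n + 2 * w + 2 + 2 * q + 2 * k < 2 * d) :
    G.OneFactorizable := by
  obtain ⟨M, hM, hMc⟩ := exists_matchingFamily_of_coloring hc hcp
  have hV : Fintype.card V = 2 * n := card_eq_two_mul_of_sides hs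
  set I : Finset ℕ := {i ∈ range k | #{v | M i v = v} ≤ m} with hI
  have hIk : I ⊆ range k := filter_subset _ _
  have hIc : #I ≤ k := by simpa using card_le_card hIk
  have hMI : IsMatchingFamily G s M I := ⟨fun i hi => hM.involutive i (hIk hi),
    fun i hi => hM.side i (hIk hi), fun i hi => hM.adj i (hIk hi),
    fun i hi j hj => hM.disjoint i (hIk hi) j (hIk hj)⟩
  have hL' : ∀ v, #{x | IsUncovered G s M (range k) v x} ≤ L := fun v =>
    le_trans (card_filter_le_of_imp fun x hx => ⟨⟨hx.1, hx.2.1⟩, hMc v x hx⟩) (hL v)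
  have hfix : ∀ v, #{i ∈ range k | M i v = v} ≤ X := fun v => by
    have h1 := hM.card_inside v
    have h2 := card_filter_add_card_filter_not (s := range k) (fun i => M i v = v)
    have h3 := hL' v
    have h4 := hD v
    rw [card_range] at h2
    simp only [ne_eq] at h1
    omega
  have hbad : #{i ∈ range k | ¬ #{v | M i v = v} ≤ m} ≤ β := by
    have h1 : #{i ∈ range k | ¬ #{v | M i v = v} ≤ m} * (m + 1) ≤ 2 * n * X := by
      calc _ ≤ ∑ i ∈ range k, #{v | M i v = v} := by
            rw [← smul_eq_mul]
            exact (card_nsmul_le_sum _ _ (m + 1) fun i hi => not_le.1 (mem_filter.1 hi).2).trans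
              (sum_le_sum_of_subset (filter_subset _ _))
        _ = ∑ v, #{i ∈ range k | M i v = v} := by
            simp only [card_filter]
            exact sum_comm
        _ ≤ _ := by
            rw [← hV, ← smul_eq_mul, ← card_univ]
            exact sum_le_card_nsmul _ _ _ fun v _ => hfix v
    have h2 : #{i ∈ range k | ¬ #{v | M i v = v} ≤ m} * (m + 1) < (β + 1) * (m + 1) := by
      rw [mul_comm (β + 1)]
      omega
    exact Nat.lt_succ_iff.1 (lt_of_mul_lt_mul_right h2 (Nat.zero_le _))
  have hunc : ∀ v, #{x | IsUncovered G s M I v x} ≤ L + β := fun v => by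
    have h1 := hM.card_inside v
    have h2 := hMI.card_inside v
    have h3 : #{i ∈ range k | M i v ≠ v} ≤ #{i ∈ I | M i v ≠ v} +
        #{i ∈ range k | ¬ #{v | M i v = v} ≤ m} := by
      refine (card_le_card fun i hi => ?_).trans (card_union_le _ _)
      simp only [hI, mem_filter, mem_union] at hi ⊢
      tauto
    have h4 := hL' v
    omega
  have hsum : ∑ v, #{x | IsUncovered G s M I v x} ≤ 2 * n * (L + β) := by
    rw [← hV, ← smul_eq_mul, ← card_univ]
    exact sum_le_card_nsmul _ _ _ fun v _ => hunc v
  refine oneFactorizable_of_nearly_perfect (c := d - #I) (m := m) (κ := κ) (σ := κ) hs (by omega)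
    (fun G' hd' hκ' => oneFactorizable_of_sparse_inside hs hd' hκ' hq (by omega)) G hMI
    (fun v => by rw [hd]; omega) (fun i hi => (mem_filter.1 hi).2)
    (fun v => (hunc v).trans hκ) ?_
  have := Nat.mul_le_mul_right (4 * m) hIc
  omega
end

section
open scoped Classical

set_option maxHeartbeats 1000000 in
/-- Regular graphs of large order `2 * n` and degree at least `(1 + ε) * n` are 1-factorizable. -/
lemma eventually_oneFactorizable (ε : ℝ) (hε : 0 < ε) (hε1 : ε ≤ 1) : ∃ N : ℕ, ∀ n ≥ N,
    ∀ (V : Type*) [Fintype V] (G : SimpleGraph V), Fintype.card V = 2 * n → ∀ d : ℕ,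
      (∀ v, #{w | G.Adj v w} = d) → (1 + ε) * n ≤ (d : ℝ) → G.OneFactorizable := by
  set ω : ℝ := ε / 16 with hω
  set κ' : ℝ := ε ^ 2 / 1000 with hκ'
  set μ : ℝ := κ' ^ 2 / 16 with hμ
  set η : ℝ := μ * κ' ^ 2 / 50 with hη
  have hω0 : 0 < ω := by positivity
  have hκ0 : 0 < κ' := by positivity
  have hμ0 : 0 < μ := by positivity
  have hη0 : 0 < η := by positivity
  have hκε : κ' ≤ ε / 1000 := by nlinarith
  have hκ1 : κ' ≤ 1 / 1000 := by linarith
  have hμκ : μ ≤ κ' / 16 := by nlinarith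
  have hημ : η ≤ μ / 50 := by
    have : κ' ^ 2 ≤ 1 := by nlinarith
    nlinarith
  have hωκ : κ' / ω = 2 * ε / 125 := by
    rw [hκ', hω]
    field_simp
    norm_num
  have hημ' : η / μ = κ' ^ 2 / 50 := by
    rw [hη]
    field_simp
  clear_value ω η μ κ'
  obtain ⟨N₁, hN₁⟩ := exists_balanced_split η hη0
  obtain ⟨N₂, hN₂⟩ := exists_partial_edgeColoring η hη0
  refine ⟨max (max N₁ N₂) (⌈1 / η⌉₊ + 1), fun n hn V _ G hV d hd hdn => ?_⟩
  have hn₁ : n ≥ N₁ := le_trans (by simp) hn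
  have hn₂ : n ≥ N₂ := le_trans (by simp) hn
  have hn₃ : ⌈1 / η⌉₊ + 1 ≤ n := le_trans (by simp) hn
  have hn0 : (0 : ℝ) < n := by
    exact_mod_cast (show 0 < n by omega)
  have hηn : 1 ≤ η * n := by
    have h1 := Nat.ceil_le.1 (show ⌈1 / η⌉₊ ≤ n by omega)
    rwa [div_le_iff₀' hη0] at h1
  have hμn : η * n ≤ μ / 50 * n := by gcongr
  have hκn : μ * n ≤ κ' / 16 * n := by gcongr
  have hεn : κ' * n ≤ ε / 1000 * n := by gcongr
  have hεn1 : ε * n ≤ n := by nlinarith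
  obtain ⟨s, hs, hsd⟩ := hN₁ n hn₁ V hV G
  have hd2 : (d : ℝ) ≤ 2 * n := by
    have : Nonempty V := Fintype.card_pos_iff.1 (by omega)
    have h1 := card_filter_le (univ : Finset V) (G.Adj (Classical.arbitrary V))
    rw [hd, card_univ, hV] at h1
    exact_mod_cast h1
  have hin : ∀ v, |(#{w | G.Adj v w ∧ s w = s v} : ℝ) - (d : ℝ) / 2| ≤ η * n := fun v => by
    have := hsd v (s v)
    rwa [hd] at this
  let H : SimpleGraph V :=
    { Adj := fun v w => G.Adj v w ∧ s w = s v
      symm := ⟨fun _ _ h => ⟨h.1.symm, h.2.symm⟩⟩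
      loopless := ⟨fun _ h => h.1.ne rfl⟩ }
  obtain ⟨k, c, hc, hcp, hk, hL⟩ := hN₂ n hn₂ V hV H (d / 2 + η * n) (by positivity) (fun v => by
    have h1 := (abs_le.1 (hin v)).2
    refine le_trans (Nat.cast_le.2 (card_filter_le_of_imp fun w h => ?_))
      (sub_le_iff_le_add'.1 h1)
    exact h) (by linarith)
  set D := ⌈(d : ℝ) / 2 - η * n⌉₊
  set L := ⌊η * n⌋₊
  set X := ⌈4 * η * n⌉₊
  set m := ⌊μ * n⌋₊
  set β := ⌊10 * (η / μ) * n⌋₊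
  set κ := ⌈κ' * n⌉₊
  set w := ⌈ω * n⌉₊
  set q := 4 * κ + (⌊κ / ω⌋₊ + 1) with hq
  have hDle : (d : ℝ) / 2 - η * n ≤ D := Nat.le_ceil _
  have hLle : (L : ℝ) ≤ η * n := Nat.floor_le (by positivity)
  have hXge : 4 * η * n ≤ X := Nat.le_ceil _
  have hXle : (X : ℝ) < 4 * η * n + 1 := Nat.ceil_lt_add_one (by positivity)
  have hmle : (m : ℝ) ≤ μ * n := Nat.floor_le (by positivity)
  have hmgt : μ * n < m + 1 := Nat.lt_floor_add_one _
  have hβle : (β : ℝ) ≤ 10 * (η / μ) * n := Nat.floor_le (by positivity)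
  have hβgt : 10 * (η / μ) * n < β + 1 := Nat.lt_floor_add_one _
  have hκge : κ' * n ≤ κ := Nat.le_ceil _
  have hκle : (κ : ℝ) < κ' * n + 1 := Nat.ceil_lt_add_one (by positivity)
  have hwge : ω * n ≤ w := Nat.le_ceil _
  have hwle : (w : ℝ) < ω * n + 1 := Nat.ceil_lt_add_one (by positivity)
  have hfle : (⌊κ / ω⌋₊ : ℝ) ≤ κ / ω := Nat.floor_le (by positivity)
  have hfgt : κ / ω < (⌊κ / ω⌋₊ : ℝ) + 1 := Nat.lt_floor_add_one _
  have hLβ : (L : ℝ) + β ≤ 11 / 50 * κ' ^ 2 * n := by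
    have h1 : η * n ≤ κ' ^ 2 / 50 * n := by
      refine mul_le_mul_of_nonneg_right ?_ hn0.le
      rw [hη, mul_div_assoc]
      exact mul_le_of_le_one_left (by positivity) (by linarith)
    rw [hημ'] at hβle
    linarith
  have hDin : ∀ v, D ≤ #{x | G.Adj v x ∧ s x = s v} := fun v => by
    refine Nat.ceil_le.2 ?_
    linarith [(abs_le.1 (hin v)).1]
  have hLin : ∀ v, #{x | (G.Adj v x ∧ s x = s v) ∧ k ≤ c v x} ≤ L := fun v =>
    le_trans (card_filter_le_of_imp fun x h => h) (Nat.le_floor (hL v))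
  clear_value D L X m β κ w
  have hkn : (k : ℝ) ≤ 2 * n := by linarith
  refine oneFactorizable_of_coloring (m := m) (D := D) (L := L) (X := X) (β := β) (κ := κ) (w := w)
    (q := q) hs hd hc (fun v x y h1 h2 h3 h4 => hcp v x y ⟨h1, h2⟩ ⟨h3, h4⟩) hDin hLin
    ?_ ?_ ?_ ?_ ?_ ?_ ?_
  · have : (k : ℝ) + L ≤ D + X := by linarith
    exact_mod_cast this
  · have h1 : (μ * n) * (10 * (η / μ) * n) < (m + 1) * (β + 1) :=
      mul_lt_mul'' hmgt hβgt (by positivity) (by positivity)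
    have h2 : (μ * n) * (10 * (η / μ) * n) = 2 * n * (5 * η * n) := by
      field_simp
      ring
    have h3 : (2 : ℝ) * n * X ≤ 2 * n * (5 * η * n) := by
      gcongr
      linarith
    have h4 : (2 : ℝ) * n * X < (m + 1) * (β + 1) := by linarith
    exact_mod_cast h4
  · have h1 : 11 / 50 * κ' ^ 2 * n ≤ κ' * n := by
      refine mul_le_mul_of_nonneg_right ?_ hn0.le
      nlinarith
    have : (L : ℝ) + β ≤ κ := by linarith
    exact_mod_cast this
  · have h1 : (2 : ℝ) * n * (L + β) ≤ 2 * n * (11 / 50 * κ' ^ 2 * n) := by gcongr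
    have h2 : (k : ℝ) * (4 * m) ≤ 2 * n * (4 * (κ' ^ 2 / 16 * n)) := by
      rw [← hμ]
      gcongr
    have h3 : (κ' * n) * (κ' * n) ≤ (κ : ℝ) * κ := by gcongr
    have h4 : 0 < (κ' * n) * (κ' * n) := by positivity
    have h5 : (2 : ℝ) * n * (L + β) + k * (4 * m) < (κ + 1) * κ := by
      have h6 : (0 : ℝ) ≤ κ := Nat.cast_nonneg κ
      linarith
    exact_mod_cast h5
  · have : (n : ℝ) + 5 * m + 4 * κ + 2 * k < 2 * d := by linarith
    exact_mod_cast this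
  · have hw0 : (0 : ℝ) < ω * n := by positivity
    have h1 : κ / ω * (ω * n) < ((⌊κ / ω⌋₊ : ℝ) + 1) * w :=
      mul_lt_mul hfgt hwge hw0 (by positivity)
    have h2 : κ / ω * (ω * n) = n * κ := by
      field_simp
    have h3 : (4 : ℝ) * κ * w + n * κ < (4 * κ + (⌊κ / ω⌋₊ + 1)) * w := by linarith
    exact_mod_cast h3
  · have h1 : (κ : ℝ) / ω ≤ 2 * (2 * ε / 125) * n := by
      rw [← hωκ, div_le_iff₀ hω0]
      have : 2 * (κ' / ω) * n * ω = 2 * κ' * n := by field_simp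
      rw [this]
      linarith
    have h2 : (n : ℝ) + 2 * w + 2 + 2 * (4 * κ + (⌊κ / ω⌋₊ + 1)) + 2 * k < 2 * d := by
      have : ω * n = ε * n / 16 := by rw [hω]; ring
      linarith
    exact_mod_cast h2
end
end

/-- For any `ε > 0` there is `N = N(ε)` such that for all `n ≥ N`, any regular
simple graph of order `2n` with degree at least `(1+ε)·n` is 1-factorizable. -/
theorem one_factorization_of_regular_simple_graph (ε : ℝ) (hε : 0 < ε) :
    ∃ N : ℕ, ∀ n : ℕ, N ≤ n →
      ∀ (V : Type) [Fintype V] (G : SimpleGraph V) [DecidableRel G.Adj],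
        Fintype.card V = 2 * n →
        ∀ d : ℕ, G.IsRegularOfDegree d → (1 + ε) * n ≤ (d : ℝ) →
          G.OneFactorizable := by
  obtain ⟨N, hN⟩ := eventually_oneFactorizable (min ε 1) (lt_min hε one_pos) (min_le_right _ _)
  refine ⟨N, fun n hn V _ G _ hV d hd hdn => hN n hn V G hV d (fun v => ?_) (le_trans ?_ hdn)⟩
  · rw [← hd v, ← G.card_neighborFinset_eq_degree, G.neighborFinset_eq_filter]
    congr
  · gcongr
    exact min_le_left _ _
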